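/- Let N ≥ 1 and m ≥ 1 be integers and let q be a real number with q > 1 if N ≤ 2m and 1 < q < (N+2m)/(N−2m) if N > 2m. If u : ℝ^N → ℝ is a C^{2m} function with u(x) ≥ 0 for all x and (−Δ)^m u(x) = u(x)^q for all x ∈ ℝ^N, then u ≡ 0. -/

import Mathlib

/-- The Laplacian of `f : ℝ^N → ℝ` at `x`, defined as the sum of the second
directional derivatives along the coordinate directions:
`Δf(x) = ∑ i, d²/dt² f(x + t eᵢ) |_{t=0}`. -/
noncomputable def lap {N : ℕ} (f : EuclideanSpace ℝ (Fin N) → ℝ)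
    (x : EuclideanSpace ℝ (Fin N)) : ℝ :=
  ∑ i : Fin N, iteratedDeriv 2 (fun t : ℝ => f (x + t • EuclideanSpace.single i (1 : ℝ))) 0

/-- `(-Δ)^m f`, the `m`-fold iterate of the Laplacian with alternating sign. -/
noncomputable def polyLap {N : ℕ} (m : ℕ) (f : EuclideanSpace ℝ (Fin N) → ℝ)
    (x : EuclideanSpace ℝ (Fin N)) : ℝ :=
  (-1 : ℝ) ^ m * (lap^[m] f x)

section PolyharmonicLiouville

open MeasureTheory Filter Topology Set

section Laplacian

variable {N : ℕ}

theorem lap_congr_nhds {f g : EuclideanSpace ℝ (Fin N) → ℝ} {x : EuclideanSpace ℝ (Fin N)}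
    (h : f =ᶠ[𝓝 x] g) : lap f x = lap g x := by
  unfold lap
  refine Finset.sum_congr rfl fun i _ => ?_
  apply Filter.EventuallyEq.iteratedDeriv_eq
  have : Tendsto (fun t : ℝ => x + t • EuclideanSpace.single i (1 : ℝ)) (𝓝 0) (𝓝 x) := by
    have : Continuous (fun t : ℝ => x + t • EuclideanSpace.single i (1 : ℝ)) := by fun_prop
    simpa using this.tendsto 0
  exact this.eventually h

theorem iteratedDeriv_two_line {f : EuclideanSpace ℝ (Fin N) → ℝ} (hf : ContDiff ℝ 2 f)
    (x e : EuclideanSpace ℝ (Fin N)) :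
    iteratedDeriv 2 (fun t : ℝ => f (x + t • e)) 0 = fderiv ℝ (fun y => fderiv ℝ f y e) x e := by
  have hline : ∀ t : ℝ, HasDerivAt (fun t : ℝ => x + t • e) e t := fun t => by
    simpa using ((hasDerivAt_id t).smul_const e).const_add x
  have h1 : deriv (fun t : ℝ => f (x + t • e)) = fun t => fderiv ℝ f (x + t • e) e := by
    funext t
    exact ((hf.differentiable (by norm_num)).differentiableAt.hasFDerivAt.comp_hasDerivAt t
      (hline t)).deriv
  rw [iteratedDeriv_succ, iteratedDeriv_one, h1]
  have hd : Differentiable ℝ (fun y => fderiv ℝ f y e) :=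
    ((hf.fderiv_right (m := 1) (by norm_num)).clm_apply contDiff_const).differentiable
      (by norm_num)
  have := (hd.differentiableAt (x := x + (0 : ℝ) • e)).hasFDerivAt.comp_hasDerivAt 0 (hline 0)
  simpa [Function.comp_def] using this.deriv

theorem lap_eq_sum_fderiv {f : EuclideanSpace ℝ (Fin N) → ℝ} (hf : ContDiff ℝ 2 f) :
    lap f = fun x => ∑ i : Fin N, fderiv ℝ (fun y => fderiv ℝ f y (EuclideanSpace.single i 1)) x
      (EuclideanSpace.single i 1) :=
  funext fun x => Finset.sum_congr rfl fun _ _ => iteratedDeriv_two_line hf x _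

theorem contDiff_lap {f : EuclideanSpace ℝ (Fin N) → ℝ} {n : ℕ}
    (hf : ContDiff ℝ (n + 2 : ℕ) f) : ContDiff ℝ n (lap f) := by
  rw [lap_eq_sum_fderiv (hf.of_le (by norm_cast; omega))]
  refine ContDiff.sum fun i _ => ?_
  have h1 : ContDiff ℝ (n + 1 : ℕ) (fun y => fderiv ℝ f y (EuclideanSpace.single i 1)) :=
    (hf.fderiv_right (by norm_cast)).clm_apply contDiff_const
  exact (h1.fderiv_right (by norm_cast)).clm_apply contDiff_const

theorem contDiff_iterate_lap {f : EuclideanSpace ℝ (Fin N) → ℝ} {n : ℕ} (m : ℕ)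
    (hf : ContDiff ℝ (n + 2 * m : ℕ) f) : ContDiff ℝ n (lap^[m] f) := by
  induction m generalizing f with
  | zero => simpa using hf
  | succ m ih =>
    rw [Function.iterate_succ_apply]
    exact ih (contDiff_lap (n := n + 2 * m) hf)

theorem lap_sub {f g : EuclideanSpace ℝ (Fin N) → ℝ} (hf : ContDiff ℝ 2 f)
    (hg : ContDiff ℝ 2 g) : lap (f - g) = lap f - lap g := by
  funext x
  rw [Pi.sub_apply, lap, lap, lap, ← Finset.sum_sub_distrib]
  refine Finset.sum_congr rfl fun i _ => ?_
  have h {h : EuclideanSpace ℝ (Fin N) → ℝ} (hh : ContDiff ℝ 2 h) :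
    ContDiff ℝ 2 (fun t : ℝ => h (x + t • EuclideanSpace.single i (1 : ℝ))) := by fun_prop
  exact iteratedDeriv_fun_sub (h hf).contDiffAt (h hg).contDiffAt

theorem iterate_lap_sub (m : ℕ) {f g : EuclideanSpace ℝ (Fin N) → ℝ}
    (hf : ContDiff ℝ (2 * m : ℕ) f) (hg : ContDiff ℝ (2 * m : ℕ) g) :
    lap^[m] (f - g) = lap^[m] f - lap^[m] g := by
  induction m generalizing f g with
  | zero => rfl
  | succ m ih =>
    simp only [Function.iterate_succ_apply]
    rw [lap_sub (hf.of_le (by norm_cast; omega)) (hg.of_le (by norm_cast; omega)),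
      ih (contDiff_lap (n := 2 * m) hf) (contDiff_lap (n := 2 * m) hg)]

theorem lap_comp_affine {f : EuclideanSpace ℝ (Fin N) → ℝ} (hf : ContDiff ℝ 2 f)
    (c : ℝ) (a : EuclideanSpace ℝ (Fin N)) (r : ℝ) :
    lap (fun y => c * f (a + r • y)) = fun y => (c * r ^ 2) * lap f (a + r • y) := by
  funext x
  rw [lap, lap, Finset.mul_sum]
  refine Finset.sum_congr rfl fun i _ => ?_
  have h : ContDiff ℝ 2
      (fun t : ℝ => f ((a + r • x) + t • EuclideanSpace.single i (1 : ℝ))) := by fun_prop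
  have h2 := congrFun (iteratedDeriv_comp_const_mul h r) 0
  simp only [mul_zero] at h2
  rw [mul_assoc, ← h2, iteratedDeriv_const_mul_field]
  congr 3
  funext t
  congr 1
  rw [smul_add, smul_smul, add_assoc]

theorem iterate_lap_comp_affine (m : ℕ) {f : EuclideanSpace ℝ (Fin N) → ℝ}
    (hf : ContDiff ℝ (2 * m : ℕ) f) (c : ℝ) (a : EuclideanSpace ℝ (Fin N)) (r : ℝ) :
    lap^[m] (fun y => c * f (a + r • y)) =
      fun y => (c * r ^ (2 * m)) * lap^[m] f (a + r • y) := by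
  induction m generalizing f c with
  | zero => simp
  | succ m ih =>
    simp only [Function.iterate_succ_apply]
    rw [lap_comp_affine (hf.of_le (by norm_cast; omega)),
      ih (contDiff_lap (n := 2 * m) hf)]
    funext y
    ring

theorem HasCompactSupport.lap {f : EuclideanSpace ℝ (Fin N) → ℝ} (hf : HasCompactSupport f) :
    HasCompactSupport (lap f) := by
  refine hf.mono' fun x hx => ?_
  by_contra h
  apply hx
  rw [lap_congr_nhds (notMem_tsupport_iff_eventuallyEq.1 h)]
  simp [_root_.lap]

theorem HasCompactSupport.iterate_lap (m : ℕ) {f : EuclideanSpace ℝ (Fin N) → ℝ}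
    (hf : HasCompactSupport f) : HasCompactSupport (_root_.lap^[m] f) := by
  induction m generalizing f with
  | zero => simpa using hf
  | succ m ih =>
    rw [Function.iterate_succ_apply]
    exact ih hf.lap

theorem integral_lap_mul {f g : EuclideanSpace ℝ (Fin N) → ℝ} (hf : ContDiff ℝ 2 f)
    (hg : ContDiff ℝ 2 g) (hgc : HasCompactSupport g) :
    ∫ x, lap f x * g x = ∫ x, f x * lap g x := by
  have hcf (i : Fin N) : ContDiff ℝ 1 (fun y => fderiv ℝ f y (EuclideanSpace.single i 1)) :=
    (hf.fderiv_right (by norm_num)).clm_apply contDiff_const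
  have hcg (i : Fin N) : ContDiff ℝ 1 (fun y => fderiv ℝ g y (EuclideanSpace.single i 1)) :=
    (hg.fderiv_right (by norm_num)).clm_apply contDiff_const
  have hcff (i : Fin N) : Continuous (fun x => fderiv ℝ (fun y => fderiv ℝ f y
      (EuclideanSpace.single i 1)) x (EuclideanSpace.single i 1)) :=
    ((hcf i).continuous_fderiv (by norm_num)).clm_apply continuous_const
  have hcgg (i : Fin N) : Continuous (fun x => fderiv ℝ (fun y => fderiv ℝ g y
      (EuclideanSpace.single i 1)) x (EuclideanSpace.single i 1)) :=
    ((hcg i).continuous_fderiv (by norm_num)).clm_apply continuous_const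
  have hsg (i : Fin N) : HasCompactSupport (fun y => fderiv ℝ g y (EuclideanSpace.single i 1)) :=
    hgc.fderiv_apply ℝ _
  have hsgg (i : Fin N) : HasCompactSupport (fun x => fderiv ℝ (fun y => fderiv ℝ g y
      (EuclideanSpace.single i 1)) x (EuclideanSpace.single i 1)) :=
    (hsg i).fderiv_apply ℝ _
  have i1 (i : Fin N) : Integrable (fun x => fderiv ℝ (fun y => fderiv ℝ f y
      (EuclideanSpace.single i 1)) x (EuclideanSpace.single i 1) * g x) :=
    ((hcff i).mul hg.continuous).integrable_of_hasCompactSupport hgc.mul_left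
  have i2 (i : Fin N) : Integrable (fun x => f x * fderiv ℝ (fun y => fderiv ℝ g y
      (EuclideanSpace.single i 1)) x (EuclideanSpace.single i 1)) :=
    (hf.continuous.mul (hcgg i)).integrable_of_hasCompactSupport (hsgg i).mul_left
  have i3 (i : Fin N) : Integrable (fun x => fderiv ℝ f x (EuclideanSpace.single i 1) *
      fderiv ℝ g x (EuclideanSpace.single i 1)) :=
    ((hcf i).continuous.mul (hcg i).continuous).integrable_of_hasCompactSupport (hsg i).mul_left
  have i4 (i : Fin N) : Integrable (fun x => fderiv ℝ f x (EuclideanSpace.single i 1) * g x) :=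
    ((hcf i).continuous.mul hg.continuous).integrable_of_hasCompactSupport hgc.mul_left
  have i5 (i : Fin N) : Integrable (fun x => f x * fderiv ℝ g x (EuclideanSpace.single i 1)) :=
    (hf.continuous.mul (hcg i).continuous).integrable_of_hasCompactSupport (hsg i).mul_left
  have df := hf.differentiable (by norm_num)
  have dg := hg.differentiable (by norm_num)
  rw [lap_eq_sum_fderiv hf, lap_eq_sum_fderiv hg]
  simp only [Finset.sum_mul, Finset.mul_sum]
  rw [integral_finsetSum _ fun i _ => i1 i, integral_finsetSum _ fun i _ => i2 i]
  refine Finset.sum_congr rfl fun i _ => ?_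
  have e1 := integral_mul_fderiv_eq_neg_fderiv_mul_of_integrable (μ := volume)
    (f := fun x => fderiv ℝ f x (EuclideanSpace.single i 1)) (g := g)
    (v := EuclideanSpace.single i 1) (i1 i) (i3 i) (i4 i)
    (fun x _ => ((hcf i).differentiable (by norm_num)).differentiableAt)
    (fun x _ => dg.differentiableAt)
  have e2 := integral_mul_fderiv_eq_neg_fderiv_mul_of_integrable (μ := volume)
    (f := f) (g := fun x => fderiv ℝ g x (EuclideanSpace.single i 1))
    (v := EuclideanSpace.single i 1) (i3 i) (i2 i) (i5 i) (fun x _ => df.differentiableAt)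
    (fun x _ => ((hcg i).differentiable (by norm_num)).differentiableAt)
  rw [e2, e1, neg_neg]

theorem integral_iterate_lap_mul (m : ℕ) {f g : EuclideanSpace ℝ (Fin N) → ℝ}
    (hf : ContDiff ℝ (2 * m : ℕ) f) (hg : ContDiff ℝ (2 * m : ℕ) g) (hgc : HasCompactSupport g) :
    ∫ x, lap^[m] f x * g x = ∫ x, f x * lap^[m] g x := by
  induction m generalizing f g with
  | zero => rfl
  | succ m ih =>
    have hg' : ContDiff ℝ (2 * m + 2 : ℕ) g := hg
    rw [Function.iterate_succ_apply,
      ih (contDiff_lap hf) (hg.of_le (by norm_cast; omega)) hgc,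
      integral_lap_mul (hf.of_le (by norm_cast; omega))
        (contDiff_iterate_lap (n := 2) m (by rwa [add_comm 2 (2 * m)])) (hgc.iterate_lap m),
      Function.iterate_succ_apply']

theorem lap_radial {g g' : ℝ → ℝ} {g'' : ℝ} {x : EuclideanSpace ℝ (Fin N)}
    (hg : ∀ᶠ s in 𝓝 (‖x‖ ^ 2), HasDerivAt g (g' s) s) (hg' : HasDerivAt g' g'' (‖x‖ ^ 2)) :
    lap (fun y => g (‖y‖ ^ 2)) x = 4 * ‖x‖ ^ 2 * g'' + 2 * N * g' (‖x‖ ^ 2) := by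
  have hline (i : Fin N) : (fun t : ℝ => ‖x + t • EuclideanSpace.single i (1 : ℝ)‖ ^ 2) =
      fun t => ‖x‖ ^ 2 + 2 * x i * t + t ^ 2 := by
    funext t
    rw [norm_add_sq_real, inner_smul_right, norm_smul, EuclideanSpace.inner_single_right]
    simp
    ring
  have hd (i : Fin N) (t : ℝ) : HasDerivAt (fun t : ℝ => ‖x‖ ^ 2 + 2 * x i * t + t ^ 2)
      (2 * x i + 2 * t) t := by
    have := (((hasDerivAt_id t).const_mul (2 * x i)).const_add (‖x‖ ^ 2)).add
      ((hasDerivAt_id t).pow 2)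
    convert! this using 1
    simp
  have key (i : Fin N) :
      iteratedDeriv 2 (fun t : ℝ => g (‖x + t • EuclideanSpace.single i (1 : ℝ)‖ ^ 2)) 0 =
        4 * x i ^ 2 * g'' + 2 * g' (‖x‖ ^ 2) := by
    have hc : Tendsto (fun t : ℝ => ‖x‖ ^ 2 + 2 * x i * t + t ^ 2) (𝓝 0) (𝓝 (‖x‖ ^ 2)) := by
      simpa using (hd i 0).continuousAt.tendsto
    have h1 : deriv (fun t : ℝ => g (‖x‖ ^ 2 + 2 * x i * t + t ^ 2)) =ᶠ[𝓝 0]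
        fun t => g' (‖x‖ ^ 2 + 2 * x i * t + t ^ 2) * (2 * x i + 2 * t) := by
      filter_upwards [hc.eventually hg] with t ht
      exact (ht.comp t (hd i t)).deriv
    have h2 : HasDerivAt (fun t => g' (‖x‖ ^ 2 + 2 * x i * t + t ^ 2) * (2 * x i + 2 * t))
        (4 * x i ^ 2 * g'' + 2 * g' (‖x‖ ^ 2)) 0 := by
      have hg0 : HasDerivAt g' g'' (‖x‖ ^ 2 + 2 * x i * 0 + 0 ^ 2) := by simpa using hg'
      have := (hg0.comp 0 (hd i 0)).mul
        (((hasDerivAt_id (0 : ℝ)).const_mul 2).const_add (2 * x i))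
      convert! this using 1
      simp
      ring
    have := fun t => congrFun (hline i) t
    simp only at this
    simp only [this]
    rw [iteratedDeriv_succ, iteratedDeriv_one, h1.deriv_eq, h2.deriv]
  rw [lap, Finset.sum_congr rfl fun i _ => key i, Finset.sum_add_distrib, ← Finset.sum_mul,
    ← Finset.mul_sum, EuclideanSpace.real_norm_sq_eq]
  simp
  ring

end Laplacian

section Energy

variable {N : ℕ}

open Polynomial in
theorem lap_polynomial_mul_expNegInvGlue (P : ℝ[X]) : ∃ Q : ℝ[X],
    lap (fun y : EuclideanSpace ℝ (Fin N) =>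
      P.eval (2 - ‖y‖ ^ 2)⁻¹ * expNegInvGlue (2 - ‖y‖ ^ 2)) =
    fun y => Q.eval (2 - ‖y‖ ^ 2)⁻¹ * expNegInvGlue (2 - ‖y‖ ^ 2) := by
  set D : ℝ[X] := X ^ 2 * (P - derivative P) with hD
  refine ⟨C 8 * (X ^ 2 * (D - derivative D)) - C 4 * (X * (D - derivative D)) - C (2 * N : ℝ) * D,
    funext fun x => ?_⟩
  have h0 (s : ℝ) : HasDerivAt (fun s : ℝ => 2 - s) (-1) s := by
    simpa using (hasDerivAt_id s).const_sub 2
  have h1 (s : ℝ) : HasDerivAt (fun s => P.eval (2 - s)⁻¹ * expNegInvGlue (2 - s))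
      (-(D.eval (2 - s)⁻¹ * expNegInvGlue (2 - s))) s := by
    convert! (expNegInvGlue.hasDerivAt_polynomial_eval_inv_mul P (2 - s)).comp s (h0 s) using 1
    ring
  have h2 (s : ℝ) : HasDerivAt (fun s => -(D.eval (2 - s)⁻¹ * expNegInvGlue (2 - s)))
      ((X ^ 2 * (D - derivative D)).eval (2 - s)⁻¹ * expNegInvGlue (2 - s)) s := by
    convert! ((expNegInvGlue.hasDerivAt_polynomial_eval_inv_mul D (2 - s)).comp s (h0 s)).neg
      using 1
    ring
  rw [lap_radial (g := fun s => P.eval (2 - s)⁻¹ * expNegInvGlue (2 - s))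
    (Eventually.of_forall h1) (h2 _)]
  generalize ht : 2 - ‖x‖ ^ 2 = t
  have hx : ‖x‖ ^ 2 = 2 - t := by linarith
  have hinv : t * t⁻¹ ^ 2 = t⁻¹ := by
    rcases eq_or_ne t 0 with rfl | h
    · simp
    · field_simp
  rw [hx]
  simp only [eval_sub, eval_mul, eval_C, eval_pow, eval_X]
  linear_combination (-4 * (eval t⁻¹ D - eval t⁻¹ (derivative D)) * expNegInvGlue t) * hinv

open Polynomial in
theorem iterate_lap_expNegInvGlue (m : ℕ) : ∃ Q : ℝ[X],
    lap^[m] (fun y : EuclideanSpace ℝ (Fin N) => expNegInvGlue (2 - ‖y‖ ^ 2)) =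
    fun y => Q.eval (2 - ‖y‖ ^ 2)⁻¹ * expNegInvGlue (2 - ‖y‖ ^ 2) := by
  induction m with
  | zero => exact ⟨1, by simp⟩
  | succ m ih =>
    obtain ⟨Q, hQ⟩ := ih
    rw [Function.iterate_succ_apply', hQ]
    exact lap_polynomial_mul_expNegInvGlue Q

open Polynomial in
theorem exists_abs_polynomial_mul_expNegInvGlue_le (Q : ℝ[X]) {θ : ℝ} (h0 : 0 < θ) (h1 : θ < 1) :
    ∃ C : ℝ, 0 < C ∧ ∀ t ≤ 2,
      |Q.eval t⁻¹ * expNegInvGlue t| ≤ C * expNegInvGlue t ^ θ := by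
  have ha : 0 < 1 - θ := by linarith
  have hc := expNegInvGlue.continuous_polynomial_eval_inv_mul (Q.comp (C (1 - θ)⁻¹ * X))
  obtain ⟨K, hK⟩ := (isCompact_Icc (a := (0 : ℝ)) (b := 2 / (1 - θ))).exists_bound_of_continuousOn
    hc.continuousOn
  refine ⟨max K 1, by positivity, fun t ht => ?_⟩
  rcases le_or_gt t 0 with h | h
  · rw [expNegInvGlue.zero_of_nonpos h, Real.zero_rpow h0.ne']
    simp
  have hb := hK (t / (1 - θ)) ⟨by positivity, by gcongr⟩
  have e : (1 - θ)⁻¹ * (t / (1 - θ))⁻¹ = t⁻¹ := by field_simp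
  simp only [eval_comp, eval_mul, eval_C, eval_X, e, Real.norm_eq_abs, abs_mul] at hb
  have p1 := expNegInvGlue.pos_of_pos h
  have e2 : expNegInvGlue t = expNegInvGlue (t / (1 - θ)) * expNegInvGlue t ^ θ := by
    have : 0 < t / (1 - θ) := by positivity
    simp only [expNegInvGlue, not_le.2 h, not_le.2 this, if_false]
    rw [← Real.exp_mul, ← Real.exp_add]
    congr 1
    field_simp
    ring
  rw [abs_mul]
  calc |eval t⁻¹ Q| * |expNegInvGlue t|
      = |eval t⁻¹ Q| * |expNegInvGlue (t / (1 - θ))| * expNegInvGlue t ^ θ := by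
        conv_lhs => rw [e2]
        rw [abs_mul, abs_of_nonneg (Real.rpow_nonneg p1.le θ), mul_assoc]
    _ ≤ max K 1 * expNegInvGlue t ^ θ := by
        gcongr
        exact hb.trans (le_max_left _ _)

theorem mul_le_half_rpow_add {q M w : ℝ} (hq : 1 < q) (hM : 0 ≤ M) (hw : 0 ≤ w) :
    M * w ≤ w ^ q / 2 + (2 * M) ^ (q / (q - 1)) := by
  have hq' : 0 < q - 1 := by linarith
  have e : w ^ q = w ^ (q - 1) * w := by
    rw [← Real.rpow_add_one' hw (by linarith)]
    ring_nf
  rcases le_or_gt (2 * M) (w ^ (q - 1)) with h | h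
  · have : 2 * M * w ≤ w ^ q := e ▸ by gcongr
    have : 0 ≤ (2 * M) ^ (q / (q - 1)) := by positivity
    linarith
  · have h2 : 0 < 2 * M := (Real.rpow_nonneg hw _).trans_lt h
    have h3 : w ≤ (2 * M) ^ (1 / (q - 1)) := by
      rw [one_div]
      exact ((Real.lt_rpow_inv_iff_of_pos hw h2.le hq').2 h).le
    have h4 : (2 * M) ^ (q / (q - 1)) = (2 * M) * (2 * M) ^ (1 / (q - 1)) := by
      rw [mul_comm (2 * M), ← Real.rpow_add_one h2.ne']
      congr 1
      field_simp
      ring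
    have : M * w ≤ 2 * M * (2 * M) ^ (1 / (q - 1)) := by gcongr; linarith
    have : 0 ≤ w ^ q := Real.rpow_nonneg hw q
    linarith

/-- A priori estimate on the unit ball for nonnegative solutions of `(-Δ)^m v = K v^q`. -/
theorem exists_setIntegral_rpow_le (N m : ℕ) {q : ℝ} (hq : 1 < q) :
    ∃ C : ℝ, 0 < C ∧ ∀ (K : ℝ) (v : EuclideanSpace ℝ (Fin N) → ℝ), 0 < K →
      ContDiff ℝ (2 * m : ℕ) v → (∀ x, 0 ≤ v x) → (∀ x, polyLap m v x = K * v x ^ q) →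
      ∫ x in Metric.ball 0 1, v x ^ q ≤ C * K ^ (-(q / (q - 1))) := by
  have hq0 : 0 < q := by linarith
  obtain ⟨Q, hQ⟩ := iterate_lap_expNegInvGlue (N := N) m
  obtain ⟨B, hB0, hB⟩ := exists_abs_polynomial_mul_expNegInvGlue_le Q (θ := q⁻¹) (by positivity)
    (inv_lt_one_of_one_lt₀ hq)
  set φ : EuclideanSpace ℝ (Fin N) → ℝ := fun y => expNegInvGlue (2 - ‖y‖ ^ 2) with hφ
  have hφ0 : ∀ y, 0 ≤ φ y := fun y => expNegInvGlue.nonneg _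
  have hφs : ContDiff ℝ (2 * m : ℕ) φ :=
    (expNegInvGlue.contDiff (n := (2 * m : ℕ))).comp (contDiff_const.sub (contDiff_norm_sq ℝ))
  have hφz : ∀ y ∉ Metric.closedBall (0 : EuclideanSpace ℝ (Fin N)) 2, φ y = 0 := fun y hy => by
    have : 2 < ‖y‖ := by simpa using hy
    exact expNegInvGlue.zero_of_nonpos (by nlinarith)
  have hφc : HasCompactSupport φ :=
    HasCompactSupport.intro (isCompact_closedBall (0 : EuclideanSpace ℝ (Fin N)) 2) hφz
  set V := volume.real (Metric.closedBall (0 : EuclideanSpace ℝ (Fin N)) 2)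
  refine ⟨Real.exp 1 * (2 * ((2 * B) ^ (q / (q - 1)) * (V + 1))), by positivity,
    fun K v hK hv hv0 heq => ?_⟩
  have hvc := hv.continuous
  have hvq : Continuous fun x => v x ^ q := hvc.rpow_const fun x => Or.inr hq0.le
  have i1 : Integrable fun x => v x ^ q * φ x :=
    (hvq.mul hφs.continuous).integrable_of_hasCompactSupport hφc.mul_left
  have hψc : Continuous (lap^[m] φ) :=
    (contDiff_iterate_lap (n := 0) m (by simpa using hφs)).continuous
  have i2 : Integrable fun x => v x * lap^[m] φ x :=
    (hvc.mul hψc).integrable_of_hasCompactSupport (hφc.iterate_lap m).mul_left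
  have i3 : Integrable ((Metric.closedBall (0 : EuclideanSpace ℝ (Fin N)) 2).indicator
      fun _ => (2 * (B / K)) ^ (q / (q - 1))) :=
    (integrable_indicator_iff measurableSet_closedBall).2
      (integrableOn_const measure_closedBall_lt_top.ne)
  have key : ∀ x, (-1) ^ m * K⁻¹ * (v x * lap^[m] φ x) ≤ 1 / 2 * (v x ^ q * φ x) +
      (Metric.closedBall (0 : EuclideanSpace ℝ (Fin N)) 2).indicator
        (fun _ => (2 * (B / K)) ^ (q / (q - 1))) x := fun x => by
    have hb := hB (2 - ‖x‖ ^ 2) (by nlinarith [sq_nonneg ‖x‖])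
    rw [← congrFun hQ x] at hb
    by_cases hx : x ∈ Metric.closedBall (0 : EuclideanSpace ℝ (Fin N)) 2
    · rw [indicator_of_mem hx]
      have hy := mul_le_half_rpow_add hq (M := B / K) (w := v x * φ x ^ q⁻¹) (by positivity)
        (mul_nonneg (hv0 x) (Real.rpow_nonneg (hφ0 x) _))
      rw [Real.mul_rpow (hv0 x) (Real.rpow_nonneg (hφ0 x) _), ← Real.rpow_mul (hφ0 x),
        inv_mul_cancel₀ hq0.ne', Real.rpow_one] at hy
      have : (-1) ^ m * K⁻¹ * (v x * lap^[m] φ x) ≤ B / K * (v x * φ x ^ q⁻¹) := by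
        calc (-1) ^ m * K⁻¹ * (v x * lap^[m] φ x)
            ≤ |(-1) ^ m * K⁻¹ * (v x * lap^[m] φ x)| := le_abs_self _
          _ = K⁻¹ * (v x * |lap^[m] φ x|) := by
            simp [abs_mul, abs_of_pos hK, abs_of_nonneg (hv0 x)]
          _ ≤ K⁻¹ * (v x * (B * φ x ^ q⁻¹)) := by
            have := hv0 x
            gcongr
          _ = _ := by ring
      linarith
    · rw [indicator_of_notMem hx, hφz x hx]
      have : lap^[m] φ x = 0 := by
        have h0 : φ x = 0 := hφz x hx
        change expNegInvGlue (2 - ‖x‖ ^ 2) = 0 at h0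
        rw [h0, Real.zero_rpow (by positivity), mul_zero] at hb
        exact abs_nonpos_iff.1 hb
      simp [this]
  have hparts : K * ∫ x, v x ^ q * φ x = (-1) ^ m * ∫ x, v x * lap^[m] φ x := by
    rw [← integral_iterate_lap_mul m hv hφs hφc, ← integral_const_mul, ← integral_const_mul]
    congr 1
    funext x
    rw [← mul_assoc, ← heq x, polyLap]
    ring
  have hint : ∫ x, v x ^ q * φ x ≤ 1 / 2 * (∫ x, v x ^ q * φ x) +
      V * (2 * (B / K)) ^ (q / (q - 1)) := by
    have := integral_mono (i2.const_mul ((-1) ^ m * K⁻¹)) ((i1.const_mul (1 / 2)).add i3) key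
    have e3 : ∫ x, (Metric.closedBall (0 : EuclideanSpace ℝ (Fin N)) 2).indicator
        (fun _ => (2 * (B / K)) ^ (q / (q - 1))) x = V * (2 * (B / K)) ^ (q / (q - 1)) := by
      rw [integral_indicator measurableSet_closedBall, setIntegral_const, smul_eq_mul]
    rw [integral_const_mul, integral_add' (i1.const_mul (1 / 2)) i3, integral_const_mul, e3] at this
    refine le_trans (le_of_eq ?_) this
    rw [mul_right_comm, ← hparts]
    field_simp
  have hball : ∫ x in Metric.ball 0 1, v x ^ q ≤ Real.exp 1 * ∫ x, v x ^ q * φ x := by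
    rw [← integral_const_mul, ← integral_indicator Metric.isOpen_ball.measurableSet]
    refine integral_mono ?_ (i1.const_mul _) fun x => ?_
    · rw [integrable_indicator_iff Metric.isOpen_ball.measurableSet]
      exact (hvq.locallyIntegrable.integrableOn_isCompact
        (isCompact_closedBall (0 : EuclideanSpace ℝ (Fin N)) 1)).mono_set
        Metric.ball_subset_closedBall
    · have hvx := Real.rpow_nonneg (hv0 x) q
      by_cases hx : x ∈ Metric.ball (0 : EuclideanSpace ℝ (Fin N)) 1
      · have hx1 : ‖x‖ < 1 := by simpa using hx
        have ht : 1 ≤ 2 - ‖x‖ ^ 2 := by nlinarith [norm_nonneg x]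
        have h1 : Real.exp (-1) ≤ φ x := by
          have := expNegInvGlue.monotone ht
          refine le_trans (by norm_num [expNegInvGlue]) this
        have h2 : 1 ≤ Real.exp 1 * φ x := by
          calc 1 = Real.exp 1 * Real.exp (-1) := by rw [← Real.exp_add]; simp
            _ ≤ _ := by gcongr
        simp only [indicator_of_mem hx]
        nlinarith
      · simp only [indicator_of_notMem hx]
        have := hφ0 x
        positivity
  have hexp : (2 * (B / K)) ^ (q / (q - 1)) =
      (2 * B) ^ (q / (q - 1)) * K ^ (-(q / (q - 1))) := by
    rw [← mul_div_assoc, Real.div_rpow (by positivity) hK.le, Real.rpow_neg hK.le, div_eq_mul_inv]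
  have hfin : ∫ x, v x ^ q * φ x ≤ 2 * (V * ((2 * B) ^ (q / (q - 1)) * K ^ (-(q / (q - 1))))) := by
    rw [← hexp]
    linarith
  calc ∫ x in Metric.ball 0 1, v x ^ q ≤ Real.exp 1 * ∫ x, v x ^ q * φ x := hball
    _ ≤ Real.exp 1 * (2 * (V * ((2 * B) ^ (q / (q - 1)) * K ^ (-(q / (q - 1)))))) := by gcongr
    _ ≤ Real.exp 1 * (2 * ((V + 1) * ((2 * B) ^ (q / (q - 1)) * K ^ (-(q / (q - 1)))))) := by
      gcongr
      linarith
    _ = _ := by ring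

theorem polyLap_comp_affine {m : ℕ} {q : ℝ} {u : EuclideanSpace ℝ (Fin N) → ℝ}
    (hu : ContDiff ℝ (2 * m : ℕ) u) (heq : ∀ x, polyLap m u x = u x ^ q)
    (a : EuclideanSpace ℝ (Fin N)) (R : ℝ) (x : EuclideanSpace ℝ (Fin N)) :
    polyLap m (fun y => u (a + R • y)) x = R ^ (2 * m) * u (a + R • x) ^ q := by
  have h := congrFun (iterate_lap_comp_affine m hu 1 a R) x
  simp only [one_mul] at h
  rw [polyLap, h, ← heq, polyLap]
  ring

/-- Averages over balls of radius `R` of `u ^ q`, for a nonnegative solution `u`, decay at a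
universal rate. -/
theorem exists_setIntegral_rpow_comp_le {m : ℕ} {q : ℝ} (hq : 1 < q)
    {u : EuclideanSpace ℝ (Fin N) → ℝ} (hu : ContDiff ℝ (2 * m : ℕ) u) (hpos : ∀ x, 0 ≤ u x)
    (heq : ∀ x, polyLap m u x = u x ^ q) : ∃ C : ℝ, 0 < C ∧
    ∀ (a : EuclideanSpace ℝ (Fin N)) (R : ℝ), 0 < R →
      ∫ x in Metric.ball 0 1, u (a + R • x) ^ q ≤ C * R ^ (-(2 * m * q / (q - 1))) := by
  obtain ⟨C, hC, h⟩ := exists_setIntegral_rpow_le N m hq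
  refine ⟨C, hC, fun a R hR => ?_⟩
  have := h (R ^ (2 * m)) (fun y => u (a + R • y)) (by positivity)
    (hu.comp (by fun_prop)) (fun _ => hpos _) (polyLap_comp_affine hu heq a R)
  rw [← Real.rpow_natCast, ← Real.rpow_mul hR.le] at this
  convert this using 3
  push_cast
  ring

end Energy

section TruncatedKernel

variable {N : ℕ}

/-- The power `‖y‖ ^ (-b)`, smoothly cut off near the origin. -/
noncomputable def truncatedKernel (b : ℝ) (y : EuclideanSpace ℝ (Fin N)) : ℝ :=
  (‖y‖ ^ 2) ^ (-(b / 2)) * Real.smoothTransition (4 * ‖y‖ ^ 2 - 1)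

theorem contDiff_truncatedKernel (b : ℝ) (n : ℕ) :
    ContDiff ℝ n (truncatedKernel b : EuclideanSpace ℝ (Fin N) → ℝ) := by
  have hg : ContDiff ℝ n (fun s : ℝ => s ^ (-(b / 2)) * Real.smoothTransition (4 * s - 1)) := by
    refine contDiff_iff_contDiffAt.2 fun s => ?_
    rcases lt_or_ge s (1 / 4) with h | h
    · refine contDiffAt_const (c := (0 : ℝ)) |>.congr_of_eventuallyEq ?_
      filter_upwards [Iio_mem_nhds h] with t ht
      rw [Real.smoothTransition.zero_of_nonpos (by linarith [mem_Iio.1 ht]), mul_zero]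
    · refine (Real.contDiffAt_rpow_const_of_ne (by linarith)).mul ?_
      exact (Real.smoothTransition.contDiff (n := (n : ℕ∞))).contDiffAt.comp s
        (by fun_prop)
  exact hg.comp (contDiff_norm_sq ℝ)

theorem lap_normSq_rpow (c e : ℝ) {x : EuclideanSpace ℝ (Fin N)} (hx : x ≠ 0) :
    lap (fun y => c * (‖y‖ ^ 2) ^ e) x = c * (4 * e * (e - 1 + N / 2)) * (‖x‖ ^ 2) ^ (e - 1) := by
  have hs : 0 < ‖x‖ ^ 2 := by positivity
  rw [lap_radial (g := fun s => c * s ^ e) (g' := fun s => c * (e * s ^ (e - 1)))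
    (g'' := c * (e * ((e - 1) * (‖x‖ ^ 2) ^ (e - 1 - 1))))]
  · rw [Real.rpow_sub_one hs.ne' (e - 1)]
    field_simp
    ring
  · filter_upwards [Ioi_mem_nhds hs] with s h
    exact (Real.hasDerivAt_rpow_const (Or.inl (ne_of_gt h))).const_mul c
  · exact ((Real.hasDerivAt_rpow_const (Or.inl hs.ne')).const_mul e).const_mul c

theorem iterate_lap_truncatedKernel (b : ℝ) (j : ℕ) :
    ∀ x : EuclideanSpace ℝ (Fin N), 1 / 2 < ‖x‖ ^ 2 → lap^[j] (truncatedKernel b) x =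
      (∏ i ∈ Finset.range j, 4 * (-(b / 2) - i) * (-(b / 2) - i - 1 + N / 2)) *
        (‖x‖ ^ 2) ^ (-(b / 2) - j) := by
  induction j with
  | zero =>
    intro x hx
    simp [truncatedKernel, Real.smoothTransition.one_of_one_le (x := 4 * ‖x‖ ^ 2 - 1)
      (by linarith)]
  | succ j ih =>
    intro x hx
    have hopen : ∀ᶠ y in 𝓝 x, 1 / 2 < ‖y‖ ^ 2 :=
      (continuous_norm.pow 2).continuousAt.eventually (Ioi_mem_nhds hx)
    rw [Function.iterate_succ_apply', lap_congr_nhds (hopen.mono ih), lap_normSq_rpow,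
      Finset.prod_range_succ]
    · rw [Nat.cast_succ, ← sub_sub]
    · rintro rfl
      norm_num at hx

theorem iterate_lap_truncatedKernel_eq_zero {m : ℕ} (hm : 0 < m) {x : EuclideanSpace ℝ (Fin N)}
    (hx : 1 / 2 < ‖x‖ ^ 2) : lap^[m] (truncatedKernel ((N : ℝ) - 2 * m)) x = 0 := by
  rw [iterate_lap_truncatedKernel _ _ x hx, Finset.prod_eq_zero (i := m - 1), zero_mul]
  · simpa using hm
  · rw [Nat.cast_sub hm]
    push_cast
    ring

/-- The kernel `‖y‖ ^ (-b)` cut off at scale `r`. -/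
theorem rpow_mul_truncatedKernel (b : ℝ) {r : ℝ} (hr : 0 < r) (y : EuclideanSpace ℝ (Fin N)) :
    r ^ (-b) * truncatedKernel b (0 + r⁻¹ • y) =
      ‖y‖ ^ (-b) * Real.smoothTransition (4 * (‖y‖ / r) ^ 2 - 1) := by
  have h : ‖(0 : EuclideanSpace ℝ (Fin N)) + r⁻¹ • y‖ = ‖y‖ / r := by
    rw [zero_add, norm_smul, norm_inv, Real.norm_of_nonneg hr.le]
    field_simp
  have h0 : 0 ≤ ‖y‖ / r := by positivity
  have h2 : ((‖y‖ / r) ^ 2) ^ (-(b / 2)) = (‖y‖ / r) ^ (-b) := by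
    rw [← Real.rpow_natCast, ← Real.rpow_mul h0]
    congr 1
    push_cast
    ring
  rw [truncatedKernel, h, h2, Real.div_rpow (norm_nonneg _) hr.le, ← mul_assoc]
  have : r ^ (-b) ≠ 0 := (Real.rpow_pos_of_pos hr _).ne'
  field_simp

end TruncatedKernel

section Representation

variable {N m : ℕ} {q : ℝ} {u : EuclideanSpace ℝ (Fin N) → ℝ}

theorem le_add_rpow_mul_rpow {q δ w : ℝ} (hq : 1 < q) (hδ : 0 < δ) (hw : 0 ≤ w) :
    w ≤ δ + δ ^ (1 - q) * w ^ q := by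
  rcases le_or_gt w δ with h | h
  · have : 0 ≤ δ ^ (1 - q) * w ^ q := by positivity
    linarith
  · have hw0 : 0 < w := hδ.trans h
    have e : w = w ^ (1 - q) * w ^ q := by
      rw [← Real.rpow_add hw0]
      simp
    have : w ^ (1 - q) ≤ δ ^ (1 - q) :=
      Real.rpow_le_rpow_of_nonpos hδ h.le (by linarith)
    have h2 : w ^ (1 - q) * w ^ q ≤ δ ^ (1 - q) * w ^ q := by gcongr
    linarith

theorem integrableOn_ball_of_continuous {f : EuclideanSpace ℝ (Fin N) → ℝ} (hf : Continuous f)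
    (x : EuclideanSpace ℝ (Fin N)) (r : ℝ) : IntegrableOn f (Metric.ball x r) :=
  (hf.locallyIntegrable.integrableOn_isCompact (isCompact_closedBall x r)).mono_set
    Metric.ball_subset_closedBall

/-- Averages of a nonnegative solution over large balls tend to zero. -/
theorem tendsto_setIntegral_comp_atTop (hm : 0 < m) (hq : 1 < q) (hu : ContDiff ℝ (2 * m : ℕ) u)
    (hpos : ∀ x, 0 ≤ u x) (heq : ∀ x, polyLap m u x = u x ^ q) (a : EuclideanSpace ℝ (Fin N)) :
    Tendsto (fun R : ℝ => ∫ x in Metric.ball 0 1, u (a + R • x)) atTop (𝓝 0) := by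
  obtain ⟨C, hC, h⟩ := exists_setIntegral_rpow_comp_le hq hu hpos heq
  have hq1 : 0 < q - 1 := by linarith
  have he : 0 < 2 * m * q / (q - 1) := by positivity
  set V := volume.real (Metric.ball (0 : EuclideanSpace ℝ (Fin N)) 1)
  have hc := hu.continuous
  have hbd (δ : ℝ) (hδ : 0 < δ) (R : ℝ) (hR : 0 < R) : ∫ x in Metric.ball 0 1, u (a + R • x) ≤
      V * δ + δ ^ (1 - q) * (C * R ^ (-(2 * m * q / (q - 1)))) := by
    have hcq : Continuous fun x => u (a + R • x) ^ q :=
      (hc.comp (by fun_prop)).rpow_const fun x => Or.inr (by linarith)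
    have i1 : IntegrableOn (fun x => u (a + R • x)) (Metric.ball 0 1) :=
      integrableOn_ball_of_continuous (hc.comp (by fun_prop)) _ _
    have i2 := integrableOn_ball_of_continuous hcq 0 1
    have i3 : IntegrableOn (fun _ => δ) (Metric.ball (0 : EuclideanSpace ℝ (Fin N)) 1) :=
      integrableOn_ball_of_continuous continuous_const _ _
    calc ∫ x in Metric.ball 0 1, u (a + R • x)
        ≤ ∫ x in Metric.ball 0 1, (δ + δ ^ (1 - q) * u (a + R • x) ^ q) :=
          integral_mono i1 (i3.add (i2.const_mul _)) fun x => le_add_rpow_mul_rpow hq hδ (hpos _)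
      _ = V * δ + δ ^ (1 - q) * ∫ x in Metric.ball 0 1, u (a + R • x) ^ q := by
          rw [integral_add i3 (i2.const_mul _), integral_const_mul, setIntegral_const, smul_eq_mul]
      _ ≤ _ := by
          have := h a R hR
          gcongr
  rw [Metric.tendsto_nhds]
  intro ε hε
  set δ := ε / (2 * (V + 1)) with hδ
  have hV : 0 ≤ V := measureReal_nonneg
  have hδ0 : 0 < δ := by positivity
  have hVδ : V * δ ≤ ε / 2 := by
    rw [hδ, mul_div_assoc', div_le_div_iff₀ (by positivity) (by positivity)]
    nlinarith
  have ht : Tendsto (fun R : ℝ => δ ^ (1 - q) * (C * R ^ (-(2 * m * q / (q - 1))))) atTop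
      (𝓝 0) := by
    simpa using ((tendsto_rpow_neg_atTop he).const_mul C).const_mul (δ ^ (1 - q))
  filter_upwards [ht.eventually_lt_const (half_pos hε), eventually_gt_atTop 0] with R h1 h2
  have h3 := hbd δ hδ0 R h2
  have h4 : 0 ≤ ∫ x in Metric.ball 0 1, u (a + R • x) := integral_nonneg fun _ => hpos _
  rw [Real.dist_eq, sub_zero, abs_of_nonneg h4]
  linarith

theorem eq_zero_of_le (hm : 0 < m) (hNm : N ≤ 2 * m) (hq : 1 < q)
    (hu : ContDiff ℝ (2 * m : ℕ) u) (hpos : ∀ x, 0 ≤ u x)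
    (heq : ∀ x, polyLap m u x = u x ^ q) (a : EuclideanSpace ℝ (Fin N)) : u a = 0 := by
  by_contra hne
  have ha : 0 < u a := lt_of_le_of_ne (hpos a) (Ne.symm hne)
  obtain ⟨C, hC, h⟩ := exists_setIntegral_rpow_comp_le hq hu hpos heq
  have hq1 : 0 < q - 1 := by linarith
  have he : (N : ℝ) < 2 * m * q / (q - 1) := by
    rw [lt_div_iff₀ hq1]
    have h1 : (N : ℝ) ≤ 2 * m := by exact_mod_cast hNm
    have h2 : (0 : ℝ) < 2 * m := by positivity
    nlinarith
  have hc := hu.continuous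
  obtain ⟨r, hr, hball⟩ := Metric.eventually_nhds_iff_ball.1
    (hc.continuousAt.eventually (Ioi_mem_nhds (half_lt_self ha)))
  set V := volume.real (Metric.ball (0 : EuclideanSpace ℝ (Fin N)) 1) with hVdef
  have hV : 0 < V := ENNReal.toReal_pos (Metric.measure_ball_pos _ _ one_pos).ne'
    measure_ball_lt_top.ne
  have hlow (R : ℝ) (hR : max r 1 < R) : (r / R) ^ N * V * (u a / 2) ^ q ≤
      C * R ^ (-(2 * m * q / (q - 1))) := by
    have hRr : r < R := (le_max_left _ _).trans_lt hR
    have hR0 : 0 < R := hr.trans hRr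
    have hcq : Continuous fun x => u (a + R • x) ^ q :=
      (hc.comp (by fun_prop)).rpow_const fun x => Or.inr (by linarith)
    have hvol : volume.real (Metric.ball (0 : EuclideanSpace ℝ (Fin N)) (r / R)) =
        (r / R) ^ N * V := by
      have := congrArg ENNReal.toReal (Measure.addHaar_ball_mul_of_pos
        (volume : Measure (EuclideanSpace ℝ (Fin N))) 0 (r := r / R) (by positivity) 1)
      have h0 : 0 ≤ r / R := by positivity
      simpa [ENNReal.toReal_mul, ENNReal.toReal_ofReal, h0, hVdef, measureReal_def] using this
    have hsub : Metric.ball (0 : EuclideanSpace ℝ (Fin N)) (r / R) ⊆ Metric.ball 0 1 :=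
      Metric.ball_subset_ball ((div_le_one hR0).2 hRr.le)
    refine le_trans ?_ (h a R hR0)
    calc (r / R) ^ N * V * (u a / 2) ^ q
        = ∫ x in Metric.ball (0 : EuclideanSpace ℝ (Fin N)) (r / R), (u a / 2) ^ q := by
          rw [setIntegral_const, hvol, smul_eq_mul]
      _ ≤ ∫ x in Metric.ball (0 : EuclideanSpace ℝ (Fin N)) (r / R), u (a + R • x) ^ q := by
          refine setIntegral_mono_on (integrableOn_ball_of_continuous continuous_const _ _)
            (integrableOn_ball_of_continuous hcq _ _) measurableSet_ball fun x hx => ?_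
          have hx' : ‖x‖ < r / R := by simpa using hx
          refine Real.rpow_le_rpow (by positivity) (le_of_lt (hball _ ?_)) (by linarith)
          rw [Metric.mem_ball, dist_eq_norm, add_sub_cancel_left, norm_smul,
            Real.norm_of_nonneg hR0.le]
          rw [lt_div_iff₀ hR0] at hx'
          linarith
      _ ≤ _ := setIntegral_mono_set (integrableOn_ball_of_continuous hcq _ _)
          (Eventually.of_forall fun x => Real.rpow_nonneg (hpos _) _) hsub.eventuallyLE
  have ht : Tendsto (fun R : ℝ => C * R ^ (-(2 * m * q / (q - 1) - N))) atTop (𝓝 0) := by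
    simpa using (tendsto_rpow_neg_atTop (sub_pos.2 he)).const_mul C
  have hK : 0 < r ^ N * V * (u a / 2) ^ q := by positivity
  obtain ⟨R, hR1, hR2⟩ := ((ht.eventually_lt_const hK).and (eventually_gt_atTop (max r 1))).exists
  have hR0 : 0 < R := hr.trans ((le_max_left _ _).trans_lt hR2)
  have h3 := hlow R hR2
  rw [neg_sub, sub_eq_neg_add, Real.rpow_add hR0, Real.rpow_natCast] at hR1
  have h4 : r ^ N * V * (u a / 2) ^ q = R ^ N * ((r / R) ^ N * V * (u a / 2) ^ q) := by
    rw [div_pow]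
    field_simp
  rw [h4] at hR1
  have : R ^ N * ((r / R) ^ N * V * (u a / 2) ^ q) ≤
      R ^ N * (C * R ^ (-(2 * m * q / (q - 1)))) := by gcongr
  linarith

end Representation

section Representation

variable {N m : ℕ} {q : ℝ} {u : EuclideanSpace ℝ (Fin N) → ℝ}

theorem iterate_lap_truncatedKernel_eq_zero' (hm : 0 < m) {x : EuclideanSpace ℝ (Fin N)}
    (hx : x ∉ Metric.ball (0 : EuclideanSpace ℝ (Fin N)) 1) :
    lap^[m] (truncatedKernel ((N : ℝ) - 2 * m)) x = 0 := by
  have : 1 ≤ ‖x‖ := by simpa using hx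
  exact iterate_lap_truncatedKernel_eq_zero hm (by nlinarith)

theorem continuous_iterate_lap_truncatedKernel (b : ℝ) (m : ℕ) :
    Continuous (lap^[m] (truncatedKernel b) : EuclideanSpace ℝ (Fin N) → ℝ) :=
  (contDiff_iterate_lap (n := 0) m (contDiff_truncatedKernel b _)).continuous

/-- Testing the equation against the difference of two truncated kernels. -/
theorem integral_rpow_mul_truncatedKernel_sub (hm : 0 < m) (hq : 1 < q)
    (hu : ContDiff ℝ (2 * m : ℕ) u) (heq : ∀ x, polyLap m u x = u x ^ q)
    (a : EuclideanSpace ℝ (Fin N)) {ε R : ℝ} (hε : 0 < ε) (hR : 0 < R) :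
    Integrable (fun y => u (a + y) ^ q * (‖y‖ ^ (-((N : ℝ) - 2 * m)) *
      Real.smoothTransition (4 * (‖y‖ / ε) ^ 2 - 1) - ‖y‖ ^ (-((N : ℝ) - 2 * m)) *
      Real.smoothTransition (4 * (‖y‖ / R) ^ 2 - 1))) ∧
    ∫ y, u (a + y) ^ q * (‖y‖ ^ (-((N : ℝ) - 2 * m)) *
      Real.smoothTransition (4 * (‖y‖ / ε) ^ 2 - 1) - ‖y‖ ^ (-((N : ℝ) - 2 * m)) *
      Real.smoothTransition (4 * (‖y‖ / R) ^ 2 - 1)) =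
    (-1) ^ m * ((∫ y, u (a + ε • y) * lap^[m] (truncatedKernel ((N : ℝ) - 2 * m)) y) -
      ∫ y, u (a + R • y) * lap^[m] (truncatedKernel ((N : ℝ) - 2 * m)) y) := by
  set b := (N : ℝ) - 2 * m with hb
  set A : ℝ → EuclideanSpace ℝ (Fin N) → ℝ :=
    fun r y => r ^ (-b) * truncatedKernel b (0 + r⁻¹ • y) with hA
  have hAeq (r : ℝ) (hr : 0 < r) (y : EuclideanSpace ℝ (Fin N)) : A r y =
      ‖y‖ ^ (-b) * Real.smoothTransition (4 * (‖y‖ / r) ^ 2 - 1) := rpow_mul_truncatedKernel b hr y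
  have hAs (r : ℝ) : ContDiff ℝ (2 * m : ℕ) (A r) :=
    contDiff_const.mul ((contDiff_truncatedKernel b _).comp (by fun_prop))
  have hlap (r : ℝ) : lap^[m] (A r) = fun y => (r ^ (-b) * r⁻¹ ^ (2 * m)) *
      lap^[m] (truncatedKernel b) (0 + r⁻¹ • y) :=
    iterate_lap_comp_affine m (contDiff_truncatedKernel b _) _ 0 r⁻¹
  have hTs : ContDiff ℝ (2 * m : ℕ) (A ε - A R) := (hAs ε).sub (hAs R)
  have hTc : HasCompactSupport (A ε - A R) := by
    refine HasCompactSupport.intro (isCompact_closedBall 0 (max ε R)) fun y hy => ?_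
    have hy' : max ε R < ‖y‖ := by simpa using hy
    have h1 (r : ℝ) (hr : 0 < r) (hry : r < ‖y‖) :
        Real.smoothTransition (4 * (‖y‖ / r) ^ 2 - 1) = 1 := by
      refine Real.smoothTransition.one_of_one_le ?_
      have : 1 ≤ ‖y‖ / r := (one_le_div hr).2 hry.le
      nlinarith
    rw [Pi.sub_apply, hAeq ε hε, hAeq R hR, h1 ε hε ((le_max_left _ _).trans_lt hy'),
      h1 R hR ((le_max_right _ _).trans_lt hy'), sub_self]
  have hva : ContDiff ℝ (2 * m : ℕ) fun y => u (a + y) := hu.comp (by fun_prop)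
  have hint (r : ℝ) (hr : 0 < r) : Integrable (fun y => u (a + y) * lap^[m] (A r) y) := by
    refine Continuous.integrable_of_hasCompactSupport ?_ (HasCompactSupport.intro
      (isCompact_closedBall (0 : EuclideanSpace ℝ (Fin N)) r) fun y hy => ?_)
    · exact hva.continuous.mul (contDiff_iterate_lap (n := 0) m (by simpa using hAs r)).continuous
    · have hy' : r < ‖y‖ := by simpa using hy
      simp only [hlap]
      rw [iterate_lap_truncatedKernel_eq_zero' hm]
      · simp
      · rw [mem_ball_zero_iff, zero_add, norm_smul, norm_inv, Real.norm_of_nonneg hr.le,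
          inv_mul_lt_iff₀ hr]
        linarith
  have hscale (r : ℝ) (hr : 0 < r) : ∫ y, u (a + y) * lap^[m] (A r) y =
      ∫ y, u (a + r • y) * lap^[m] (truncatedKernel b) y := by
    have h := Measure.integral_comp_inv_smul_of_nonneg volume
      (fun y => u (a + r • y) * lap^[m] (truncatedKernel b) y) hr.le
    rw [finrank_euclideanSpace_fin, smul_eq_mul] at h
    have h1 : r ^ (-b) * r⁻¹ ^ (2 * m) * r ^ N = 1 := by
      have : r ^ N = r ^ b * r ^ (2 * m) := by
        rw [← Real.rpow_natCast, ← Real.rpow_natCast, ← Real.rpow_add hr]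
        congr 1
        push_cast
        ring
      have h2 := (Real.rpow_pos_of_pos hr b).ne'
      rw [this, Real.rpow_neg hr.le, inv_pow]
      field_simp
    rw [← one_mul (∫ y, u (a + r • y) * lap^[m] (truncatedKernel b) y), ← h1, mul_assoc, ← h,
      ← integral_const_mul]
    congr 1
    funext y
    rw [hlap, smul_smul, mul_inv_cancel₀ hr.ne', one_smul]
    simp only [zero_add]
    ring
  have hAe : ∀ y, u (a + y) ^ q * (‖y‖ ^ (-b) *
      Real.smoothTransition (4 * (‖y‖ / ε) ^ 2 - 1) - ‖y‖ ^ (-b) *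
      Real.smoothTransition (4 * (‖y‖ / R) ^ 2 - 1)) = u (a + y) ^ q * (A ε - A R) y := fun y => by
    rw [Pi.sub_apply, hAeq ε hε, hAeq R hR]
  have hpde (y : EuclideanSpace ℝ (Fin N)) :
      u (a + y) ^ q = (-1) ^ m * lap^[m] (fun y => u (a + y)) y := by
    have := polyLap_comp_affine hu heq a 1 y
    simp only [one_smul, one_pow, one_mul] at this
    rw [← this, polyLap]
  simp only [hAe]
  constructor
  · refine Continuous.integrable_of_hasCompactSupport ?_ hTc.mul_left
    exact (hva.continuous.rpow_const fun _ => Or.inr (by linarith)).mul hTs.continuous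
  · simp only [hpde, mul_assoc]
    rw [integral_const_mul, integral_iterate_lap_mul m hva hTs hTc,
      iterate_lap_sub m (hAs ε) (hAs R), ← hscale ε hε, ← hscale R hR,
      ← integral_sub (hint ε hε) (hint R hR)]
    simp only [Pi.sub_apply, mul_sub]

theorem tendsto_integral_iterate_lap_zero (hm : 0 < m) (hu : Continuous u)
    (a : EuclideanSpace ℝ (Fin N)) :
    Tendsto (fun r : ℝ => ∫ y, u (a + r • y) * lap^[m] (truncatedKernel ((N : ℝ) - 2 * m)) y)
      (𝓝 0) (𝓝 (u a * ∫ y : EuclideanSpace ℝ (Fin N),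
        lap^[m] (truncatedKernel ((N : ℝ) - 2 * m)) y)) := by
  set L : EuclideanSpace ℝ (Fin N) → ℝ := lap^[m] (truncatedKernel ((N : ℝ) - 2 * m)) with hL
  have hLc : Continuous L := continuous_iterate_lap_truncatedKernel _ _
  have h1 (r : ℝ) : ∫ y, u (a + r • y) * L y =
      ∫ y in Metric.closedBall 0 1, u (a + r • y) * L y := by
    refine (setIntegral_eq_integral_of_forall_compl_eq_zero fun y hy => ?_).symm
    rw [hL, iterate_lap_truncatedKernel_eq_zero' hm fun h => hy (Metric.ball_subset_closedBall h),
      mul_zero]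
  have h2 : Continuous fun r : ℝ => ∫ y in Metric.closedBall 0 1, u (a + r • y) * L y := by
    refine continuous_parametric_integral_of_continuous (f := fun r y => u (a + r • y) * L y) ?_
      (isCompact_closedBall _ _)
    fun_prop
  simp only [h1]
  convert h2.tendsto 0 using 2
  rw [← h1, ← integral_const_mul]
  simp

theorem tendsto_integral_iterate_lap_atTop (hm : 0 < m) (hq : 1 < q)
    (hu : ContDiff ℝ (2 * m : ℕ) u)
    (hpos : ∀ x, 0 ≤ u x) (heq : ∀ x, polyLap m u x = u x ^ q) (a : EuclideanSpace ℝ (Fin N)) :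
    Tendsto (fun r : ℝ => ∫ y, u (a + r • y) * lap^[m] (truncatedKernel ((N : ℝ) - 2 * m)) y)
      atTop (𝓝 0) := by
  set L : EuclideanSpace ℝ (Fin N) → ℝ := lap^[m] (truncatedKernel ((N : ℝ) - 2 * m)) with hL
  have hLc : Continuous L := continuous_iterate_lap_truncatedKernel _ _
  obtain ⟨K, hK⟩ :=
    (isCompact_closedBall (0 : EuclideanSpace ℝ (Fin N)) 1).exists_bound_of_continuousOn
    hLc.continuousOn
  refine squeeze_zero_norm (a := fun r => K * ∫ x in Metric.ball 0 1, u (a + r • x))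
    (fun r => ?_) (by simpa using (tendsto_setIntegral_comp_atTop hm hq hu hpos heq a).const_mul K)
  have hc : Continuous fun y => u (a + r • y) := hu.continuous.comp (by fun_prop)
  have h1 : ∫ y, u (a + r • y) * L y = ∫ y in Metric.ball 0 1, u (a + r • y) * L y := by
    refine (setIntegral_eq_integral_of_forall_compl_eq_zero fun y hy => ?_).symm
    rw [hL, iterate_lap_truncatedKernel_eq_zero' hm hy, mul_zero]
  rw [h1, ← integral_const_mul]
  refine norm_integral_le_of_norm_le ((integrableOn_ball_of_continuous hc _ _).const_mul K)
    ((ae_restrict_mem measurableSet_ball).mono fun y hy => ?_)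
  rw [norm_mul, Real.norm_of_nonneg (hpos _), mul_comm]
  exact mul_le_mul_of_nonneg_right (hK y (Metric.ball_subset_closedBall hy)) (hpos _)

/-- Integral representation of nonnegative entire solutions. -/
theorem exists_lintegral_eq (hm : 0 < m) (hNm : 2 * m < N) (hq : 1 < q)
    (hu : ContDiff ℝ (2 * m : ℕ) u)
    (hpos : ∀ x, 0 ≤ u x) (heq : ∀ x, polyLap m u x = u x ^ q) :
    ∃ κ : ℝ, ∀ a, ∫⁻ y, ENNReal.ofReal (u (a + y) ^ q * ‖y‖ ^ (-((N : ℝ) - 2 * m))) =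
      ENNReal.ofReal (κ * u a) := by
  refine ⟨(-1) ^ m * ∫ y : EuclideanSpace ℝ (Fin N),
    lap^[m] (truncatedKernel ((N : ℝ) - 2 * m)) y, fun a => ?_⟩
  set b := (N : ℝ) - 2 * m with hb
  have hb0 : 0 < b := by
    have : ((2 * m : ℕ) : ℝ) < N := by exact_mod_cast hNm
    push_cast at this
    linarith
  set F : ℕ → EuclideanSpace ℝ (Fin N) → ℝ := fun n y => u (a + y) ^ q * (‖y‖ ^ (-b) *
      Real.smoothTransition (4 * (‖y‖ / (1 / ((n : ℝ) + 1))) ^ 2 - 1) - ‖y‖ ^ (-b) *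
      Real.smoothTransition (4 * (‖y‖ / ((n : ℝ) + 1)) ^ 2 - 1)) with hF
  have hid (n : ℕ) := integral_rpow_mul_truncatedKernel_sub hm hq hu heq a
    (ε := 1 / ((n : ℝ) + 1)) (R := (n : ℝ) + 1) (by positivity) (by positivity)
  have huq : Continuous fun y => u (a + y) ^ q :=
    (hu.continuous.comp (by fun_prop)).rpow_const fun _ => Or.inr (by linarith)
  have hmono (y : EuclideanSpace ℝ (Fin N)) : Monotone fun n => F n y := fun n k hnk => by
    have h1 : (n : ℝ) ≤ k := by exact_mod_cast hnk
    refine mul_le_mul_of_nonneg_left (sub_le_sub ?_ ?_) (Real.rpow_nonneg (hpos _) _) <;>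
      refine mul_le_mul_of_nonneg_left (Real.smoothTransition.monotone ?_)
        (Real.rpow_nonneg (norm_nonneg _) _) <;> gcongr
  have hF0 (n : ℕ) (y : EuclideanSpace ℝ (Fin N)) : 0 ≤ F n y := by
    refine mul_nonneg (Real.rpow_nonneg (hpos _) _) (sub_nonneg.2 ?_)
    refine mul_le_mul_of_nonneg_left (Real.smoothTransition.monotone ?_)
      (Real.rpow_nonneg (norm_nonneg _) _)
    gcongr
    have h1 : (1 : ℝ) ≤ n + 1 := by simp
    exact ((div_le_one (by positivity)).2 h1).trans h1
  have hlim (y : EuclideanSpace ℝ (Fin N)) :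
      Tendsto (fun n => F n y) atTop (𝓝 (u (a + y) ^ q * ‖y‖ ^ (-b))) := by
    rcases eq_or_ne y 0 with rfl | hy
    · simp [hF, Real.zero_rpow (neg_ne_zero.2 hb0.ne')]
    have hy0 : 0 < ‖y‖ := norm_pos_iff.2 hy
    have hn : Tendsto (fun n : ℕ => (n : ℝ) + 1) atTop atTop :=
      tendsto_atTop_add_const_right _ _ tendsto_natCast_atTop_atTop
    have hev : ∀ᶠ n : ℕ in atTop, F n y = u (a + y) ^ q * ‖y‖ ^ (-b) := by
      filter_upwards [hn.eventually_ge_atTop (2 * ‖y‖), hn.eventually_ge_atTop (1 / ‖y‖)]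
        with n h1 h2
      have hp : (0 : ℝ) < n + 1 := by positivity
      have e1 : Real.smoothTransition (4 * (‖y‖ / (1 / ((n : ℝ) + 1))) ^ 2 - 1) = 1 := by
        refine Real.smoothTransition.one_of_one_le ?_
        have : 1 ≤ ‖y‖ / (1 / ((n : ℝ) + 1)) := by
          rw [div_div_eq_mul_div, div_one]
          rw [div_le_iff₀ hy0] at h2
          linarith
        nlinarith
      have e2 : Real.smoothTransition (4 * (‖y‖ / ((n : ℝ) + 1)) ^ 2 - 1) = 0 := by
        refine Real.smoothTransition.zero_of_nonpos ?_
        have : ‖y‖ / ((n : ℝ) + 1) ≤ 1 / 2 := by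
          rw [div_le_iff₀ hp]
          linarith
        have : 0 ≤ ‖y‖ / ((n : ℝ) + 1) := by positivity
        nlinarith
      simp only [hF, e1, e2, mul_one, mul_zero, sub_zero]
    exact tendsto_const_nhds.congr' (hev.mono fun _ h => h.symm)
  have hmeas (n : ℕ) : AEMeasurable fun y => ENNReal.ofReal (F n y) :=
    (hid n).1.aestronglyMeasurable.aemeasurable.ennreal_ofReal
  have hA := lintegral_tendsto_of_tendsto_of_monotone (μ := volume) hmeas
    (Eventually.of_forall fun y n k hnk => ENNReal.ofReal_le_ofReal (hmono y hnk))
    (Eventually.of_forall fun y => ENNReal.tendsto_ofReal (hlim y))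
  refine tendsto_nhds_unique hA ?_
  have hI (n : ℕ) : ∫⁻ y, ENNReal.ofReal (F n y) = ENNReal.ofReal ((-1) ^ m *
      ((∫ y, u (a + (1 / ((n : ℝ) + 1)) • y) * lap^[m] (truncatedKernel b) y) -
        ∫ y, u (a + ((n : ℝ) + 1) • y) * lap^[m] (truncatedKernel b) y)) := by
    rw [← (hid n).2, ofReal_integral_eq_lintegral_ofReal (hid n).1
      (Eventually.of_forall (hF0 n))]
  simp only [hI]
  refine ENNReal.tendsto_ofReal ?_
  have t1 := (tendsto_integral_iterate_lap_zero hm hu.continuous a).comp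
    (tendsto_one_div_add_atTop_nhds_zero_nat (𝕜 := ℝ))
  have t2 := (tendsto_integral_iterate_lap_atTop hm hq hu hpos heq a).comp
    (tendsto_atTop_add_const_right _ (1 : ℝ) tendsto_natCast_atTop_atTop)
  have := (t1.sub t2).const_mul ((-1) ^ m)
  rw [sub_zero] at this
  refine (this.congr fun n => rfl).trans (le_of_eq ?_)
  rw [mul_assoc, mul_comm (u a)]

theorem integrable_and_integral_eq [Nonempty (Fin N)] {κ b : ℝ} (hu : Continuous u)
    (hpos : ∀ x, 0 ≤ u x) {z : EuclideanSpace ℝ (Fin N)} (hz : u z ≠ 0)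
    (h : ∀ a, ∫⁻ y, ENNReal.ofReal (u (a + y) ^ q * ‖y‖ ^ (-b)) = ENNReal.ofReal (κ * u a)) :
    0 < κ ∧ (∀ x, 0 < u x) ∧ ∀ x, Integrable (fun y => u y ^ q * ‖x - y‖ ^ (-b)) ∧
      ∫ y, u y ^ q * ‖x - y‖ ^ (-b) = κ * u x := by
  have hmeas (x : EuclideanSpace ℝ (Fin N)) : Measurable fun y => u y ^ q * ‖x - y‖ ^ (-b) :=
    ((hu.measurable).pow_const q).mul ((measurable_const.sub measurable_id).norm.pow_const _)
  have hnn (x y : EuclideanSpace ℝ (Fin N)) : 0 ≤ u y ^ q * ‖x - y‖ ^ (-b) :=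
    mul_nonneg (Real.rpow_nonneg (hpos _) _) (Real.rpow_nonneg (norm_nonneg _) _)
  have h' (x : EuclideanSpace ℝ (Fin N)) :
      ∫⁻ y, ENNReal.ofReal (u y ^ q * ‖x - y‖ ^ (-b)) = ENNReal.ofReal (κ * u x) := by
    rw [← h x, ← lintegral_add_left_eq_self _ x]
    simp [sub_add_cancel_left]
  have hint (x : EuclideanSpace ℝ (Fin N)) : Integrable (fun y => u y ^ q * ‖x - y‖ ^ (-b)) := by
    refine ⟨(hmeas x).aestronglyMeasurable, ?_⟩
    rw [hasFiniteIntegral_iff_ofReal (Eventually.of_forall (hnn x)), h' x]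
    exact ENNReal.ofReal_lt_top
  have hval (x : EuclideanSpace ℝ (Fin N)) :
      ∫ y, u y ^ q * ‖x - y‖ ^ (-b) = (ENNReal.ofReal (κ * u x)).toReal := by
    rw [integral_eq_lintegral_of_nonneg_ae (Eventually.of_forall (hnn x))
      (hmeas x).aestronglyMeasurable, h' x]
  have hκu (x : EuclideanSpace ℝ (Fin N)) : 0 < κ * u x := by
    by_contra hneg
    have h0 : ENNReal.ofReal (κ * u x) = 0 := ENNReal.ofReal_of_nonpos (not_lt.1 hneg)
    have h1 := h' x
    rw [h0, lintegral_eq_zero_iff (hmeas x).ennreal_ofReal] at h1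
    have h2 : u =ᵐ[volume] fun _ => 0 := by
      filter_upwards [h1, compl_mem_ae_iff.2 (measure_singleton x)] with y hy hyz
      have h2 : 0 < ‖x - y‖ ^ (-b) :=
        Real.rpow_pos_of_pos (norm_pos_iff.2 (sub_ne_zero.2 fun h => hyz h.symm)) _
      have h3 : u y ^ q * ‖x - y‖ ^ (-b) ≤ 0 := ENNReal.ofReal_eq_zero.1 hy
      by_contra h4
      have h5 : 0 < u y := lt_of_le_of_ne (hpos y) (Ne.symm h4)
      exact (mul_pos (Real.rpow_pos_of_pos h5 q) h2).not_ge h3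
    have h3 : u = fun _ => 0 := Continuous.ae_eq_iff_eq volume hu continuous_const |>.1 h2
    exact hz (congrFun h3 z)
  have hκ : 0 < κ := pos_of_mul_pos_left (hκu z) (hpos z)
  refine ⟨hκ, fun x => pos_of_mul_pos_right (hκu x) hκ.le, fun x => ⟨hint x, ?_⟩⟩
  rw [hval x, ENNReal.toReal_ofReal (mul_nonneg hκ.le (hpos x))]

end Representation

section Kelvin

open EuclideanGeometry

variable {N : ℕ}

theorem integral_eq_setIntegral_ball_add_inversion [Nonempty (Fin N)] {r : ℝ} (hr : 0 < r)
    {f : EuclideanSpace ℝ (Fin N) → ℝ} (hf : Integrable f) :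
    IntegrableOn (fun y => f y + (r / ‖y‖) ^ (2 * N) * f (inversion 0 r y)) (Metric.ball 0 r) ∧
    ∫ y, f y = ∫ y in Metric.ball 0 r, f y + (r / ‖y‖) ^ (2 * N) * f (inversion 0 r y) := by
  set s : Set (EuclideanSpace ℝ (Fin N)) := Metric.ball 0 r \ {0} with hs
  have hsm : MeasurableSet s := measurableSet_ball.diff (measurableSet_singleton 0)
  have hsb : s =ᵐ[volume] Metric.ball 0 r := sdiff_null_ae_eq_self (measure_singleton 0)
  set D : EuclideanSpace ℝ (Fin N) → EuclideanSpace ℝ (Fin N) →L[ℝ] EuclideanSpace ℝ (Fin N) :=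
    fun y => (r / dist y 0) ^ 2 • ((ℝ ∙ (y - 0))ᗮ.reflection : _ →L[ℝ] _) with hD
  have hd : ∀ y ∈ s, HasFDerivWithinAt (inversion 0 r) (D y) s y := fun y hy =>
    (hasFDerivAt_inversion hy.2).hasFDerivWithinAt
  have hinj : InjOn (inversion (0 : EuclideanSpace ℝ (Fin N)) r) s :=
    (inversion_injective 0 hr.ne').injOn
  have hdet (y : EuclideanSpace ℝ (Fin N)) : |(D y).det| = (r / ‖y‖) ^ (2 * N) := by
    have h1 : (D y).det = ((r / ‖y‖) ^ 2) ^ N *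
        LinearMap.det ((ℝ ∙ (y - 0))ᗮ.reflection.toLinearEquiv :
          EuclideanSpace ℝ (Fin N) →ₗ[ℝ] EuclideanSpace ℝ (Fin N)) := by
      simp only [hD, ContinuousLinearMap.det, dist_zero_right, ContinuousLinearMap.toLinearMap_smul]
      rw [LinearMap.det_smul, finrank_euclideanSpace_fin]
      rfl
    rw [h1, Submodule.det_reflection, abs_mul, abs_pow (-1 : ℝ), abs_neg, abs_one, one_pow,
      mul_one, ← pow_mul, abs_of_nonneg (by positivity)]
  have himg : inversion 0 r '' s = (Metric.closedBall (0 : EuclideanSpace ℝ (Fin N)) r)ᶜ := by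
    ext y
    simp only [hs, Set.mem_image, Set.mem_sdiff, mem_ball_zero_iff, mem_singleton_iff,
      mem_compl_iff, mem_closedBall_zero_iff, not_le]
    constructor
    · rintro ⟨z, ⟨h1, h2⟩, rfl⟩
      have hz : 0 < ‖z‖ := norm_pos_iff.2 h2
      rw [← dist_zero_right, dist_inversion_center, dist_zero_right, lt_div_iff₀ hz]
      nlinarith
    · intro h
      have hy : 0 < ‖y‖ := hr.trans h
      refine ⟨inversion 0 r y, ⟨?_, ?_⟩, inversion_inversion 0 hr.ne' y⟩
      · rw [← dist_zero_right, dist_inversion_center, dist_zero_right, div_lt_iff₀ hy]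
        nlinarith
      · rw [inversion_eq_center hr.ne']
        exact norm_pos_iff.1 hy
  have hI := integral_image_eq_integral_abs_det_fderiv_smul volume hsm hd hinj f
  have hInt := (integrableOn_image_iff_integrableOn_abs_det_fderiv_smul volume hsm hd hinj f).1
    hf.integrableOn
  simp only [hdet, smul_eq_mul] at hI hInt
  rw [himg, setIntegral_congr_set hsb] at hI
  rw [integrableOn_congr_set_ae hsb] at hInt
  refine ⟨hf.integrableOn.add hInt, ?_⟩
  have hbc : Metric.closedBall (0 : EuclideanSpace ℝ (Fin N)) r =ᵐ[volume] Metric.ball 0 r := by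
    rw [← Metric.ball_union_sphere]
    exact union_ae_eq_left_of_ae_eq_empty (ae_eq_empty.2 (Measure.addHaar_sphere _ _ _))
  rw [integral_add hf.integrableOn hInt, ← hI, ← setIntegral_congr_set hbc,
    integral_add_compl Metric.isClosed_closedBall.measurableSet hf]

/-- The Kelvin transform of order `b` with respect to the sphere of radius `r` about `0`. -/
noncomputable def kelvin (b r : ℝ) (u : EuclideanSpace ℝ (Fin N) → ℝ)
    (x : EuclideanSpace ℝ (Fin N)) : ℝ :=
  (r / ‖x‖) ^ b * u (inversion 0 r x)

theorem norm_sub_inversion_sq {r : ℝ} (hr : 0 < r) {x y : EuclideanSpace ℝ (Fin N)} (hy : y ≠ 0) :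
    (‖x - inversion 0 r y‖ * ‖y‖ / r) ^ 2 =
      ‖x - y‖ ^ 2 + (r ^ 2 - ‖x‖ ^ 2) * (r ^ 2 - ‖y‖ ^ 2) / r ^ 2 := by
  have hy0 : ‖y‖ ≠ 0 := norm_ne_zero_iff.2 hy
  rw [div_pow, mul_pow, inversion_def]
  simp only [dist_zero_right, vsub_eq_sub, sub_zero, vadd_eq_add, add_zero]
  rw [norm_sub_sq_real, norm_sub_sq_real, real_inner_smul_right, norm_smul, Real.norm_eq_abs,
    abs_of_nonneg (by positivity)]
  field_simp
  ring

/-- The kernel of the difference between a solution and its Kelvin transform. -/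
noncomputable def kelvinKernel (b r : ℝ) (x y : EuclideanSpace ℝ (Fin N)) : ℝ :=
  ‖x - y‖ ^ (-b) - (r / ‖y‖) ^ b * ‖x - inversion 0 r y‖ ^ (-b)

theorem div_rpow_mul_rpow_neg {r c A : ℝ} (hr : 0 < r) (hc : 0 ≤ c) (hA : 0 ≤ A) (b : ℝ) :
    (r / c) ^ b * A ^ (-b) = (c * A / r) ^ (-b) := by
  rw [mul_comm c, mul_div_assoc, Real.mul_rpow hA (by positivity), Real.rpow_neg (x := c / r)
    (by positivity), ← Real.inv_rpow (by positivity), inv_div, mul_comm]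

theorem kelvinKernel_pos {b r : ℝ} (hb : 0 < b) (hr : 0 < r) {x y : EuclideanSpace ℝ (Fin N)}
    (hx : ‖x‖ < r) (hy : ‖y‖ < r) (hy0 : y ≠ 0) (hxy : x ≠ y) : 0 < kelvinKernel b r x y := by
  have hy0' : 0 < ‖y‖ := norm_pos_iff.2 hy0
  have hxy' : 0 < ‖x - y‖ := norm_pos_iff.2 (sub_ne_zero.2 hxy)
  have h1 := norm_sub_inversion_sq hr (x := x) hy0
  have h2 : 0 < (r ^ 2 - ‖x‖ ^ 2) * (r ^ 2 - ‖y‖ ^ 2) / r ^ 2 := by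
    have : ‖x‖ ^ 2 < r ^ 2 := by gcongr
    have : ‖y‖ ^ 2 < r ^ 2 := by gcongr
    exact div_pos (mul_pos (by linarith) (by linarith)) (by positivity)
  have h3 : ‖x - y‖ < ‖x - inversion 0 r y‖ * ‖y‖ / r :=
    lt_of_pow_lt_pow_left₀ 2 (by positivity) (by linarith)
  have h4 : (r / ‖y‖) ^ b * ‖x - inversion 0 r y‖ ^ (-b) =
      (‖x - inversion 0 r y‖ * ‖y‖ / r) ^ (-b) := by
    rw [div_rpow_mul_rpow_neg hr (norm_nonneg _) (norm_nonneg _), mul_comm ‖y‖]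
  rw [kelvinKernel, h4, sub_pos]
  exact Real.rpow_lt_rpow_of_neg hxy' h3 (by linarith)

theorem kelvinKernel_le {b r : ℝ} (hr : 0 < r) (x y : EuclideanSpace ℝ (Fin N)) :
    kelvinKernel b r x y ≤ ‖x - y‖ ^ (-b) :=
  sub_le_self _ (by positivity)

end Kelvin

section MovingSpheres

open EuclideanGeometry

variable {N : ℕ} {b q κ : ℝ} {u : EuclideanSpace ℝ (Fin N) → ℝ}

theorem mul_sub_kelvin_eq [Nonempty (Fin N)] (hpos : ∀ x, 0 < u x)
    (hrep : ∀ x, Integrable (fun y => u y ^ q * ‖x - y‖ ^ (-b)) ∧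
      ∫ y, u y ^ q * ‖x - y‖ ^ (-b) = κ * u x)
    {r : ℝ} (hr : 0 < r) {x : EuclideanSpace ℝ (Fin N)} (hx : x ≠ 0) :
    IntegrableOn (fun y => kelvinKernel b r x y *
      (u y ^ q - (r / ‖y‖) ^ (2 * N - b - q * b) * kelvin b r u y ^ q)) (Metric.ball 0 r) ∧
    κ * (u x - kelvin b r u x) = ∫ y in Metric.ball 0 r, kelvinKernel b r x y *
      (u y ^ q - (r / ‖y‖) ^ (2 * N - b - q * b) * kelvin b r u y ^ q) := by
  obtain ⟨i1, e1⟩ := integral_eq_setIntegral_ball_add_inversion hr (hrep x).1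
  obtain ⟨i2, e2⟩ := integral_eq_setIntegral_ball_add_inversion hr (hrep (inversion 0 r x)).1
  have hx0 : 0 < ‖x‖ := norm_pos_iff.2 hx
  have hae : (fun y => (u y ^ q * ‖x - y‖ ^ (-b) + (r / ‖y‖) ^ (2 * N) *
        (u (inversion 0 r y) ^ q * ‖x - inversion 0 r y‖ ^ (-b))) - (r / ‖x‖) ^ b *
        (u y ^ q * ‖inversion 0 r x - y‖ ^ (-b) + (r / ‖y‖) ^ (2 * N) *
        (u (inversion 0 r y) ^ q * ‖inversion 0 r x - inversion 0 r y‖ ^ (-b))))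
      =ᵐ[volume.restrict (Metric.ball 0 r)] fun y => kelvinKernel b r x y *
        (u y ^ q - (r / ‖y‖) ^ (2 * N - b - q * b) * kelvin b r u y ^ q) := by
    refine ae_restrict_of_ae ?_
    filter_upwards [compl_mem_ae_iff.2 (measure_singleton 0)] with y hy
    have hy : y ≠ 0 := hy
    have hy0 : 0 < ‖y‖ := norm_pos_iff.2 hy
    have hρ : 0 < r / ‖y‖ := by positivity
    have h1 : (r / ‖x‖) ^ b * ‖inversion 0 r x - y‖ ^ (-b) =
        (r / ‖y‖) ^ b * ‖x - inversion 0 r y‖ ^ (-b) := by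
      have h := dist_inversion_mul_dist_center_eq (R := r) hx hy
      simp only [dist_eq_norm, sub_zero] at h
      rw [div_rpow_mul_rpow_neg hr (norm_nonneg _) (norm_nonneg _),
        div_rpow_mul_rpow_neg hr (norm_nonneg _) (norm_nonneg _), mul_comm, h, mul_comm]
    have h2 : (r / ‖x‖) ^ b * ‖inversion 0 r x - inversion 0 r y‖ ^ (-b) =
        (r / ‖y‖) ^ (-b) * ‖x - y‖ ^ (-b) := by
      have h := dist_inversion_inversion hx hy r
      simp only [dist_eq_norm, sub_zero] at h
      rw [div_rpow_mul_rpow_neg hr (norm_nonneg _) (norm_nonneg _), h,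
        ← Real.mul_rpow hρ.le (norm_nonneg _)]
      congr 1
      field_simp
    have h3 : kelvin b r u y ^ q = (r / ‖y‖) ^ (q * b) * u (inversion 0 r y) ^ q := by
      rw [kelvin, Real.mul_rpow (by positivity) (hpos _).le, ← Real.rpow_mul hρ.le, mul_comm b]
    have h4 : (r / ‖y‖) ^ (2 * N - b - q * b) * (r / ‖y‖) ^ (q * b) =
        (r / ‖y‖) ^ (2 * N) * (r / ‖y‖) ^ (-b) := by
      rw [← Real.rpow_natCast, ← Real.rpow_add hρ, ← Real.rpow_add hρ]
      congr 1
      push_cast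
      ring
    have h5 : (r / ‖y‖) ^ b * (r / ‖y‖) ^ (-b) = 1 := by
      rw [← Real.rpow_add hρ, add_neg_cancel, Real.rpow_zero]
    rw [h3, ← mul_assoc ((r / ‖y‖) ^ (2 * N - b - q * b)), h4, kelvinKernel]
    linear_combination (-(u y ^ q)) * h1 - (r / ‖y‖) ^ (2 * N) * u (inversion 0 r y) ^ q * h2 -
      (r / ‖y‖) ^ (2 * N) * u (inversion 0 r y) ^ q * ‖x - inversion 0 r y‖ ^ (-b) * h5
  refine ⟨(i1.sub (i2.const_mul _)).congr hae, ?_⟩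
  rw [← integral_congr_ae hae, integral_sub i1 (i2.const_mul _), integral_const_mul, ← e1, ← e2,
    (hrep x).2, (hrep _).2, kelvin]
  ring

theorem rpow_sub_rpow_le_mul_sub {q s t M : ℝ} (hq : 1 < q) (hs : 0 ≤ s) (hst : s ≤ t)
    (htM : t ≤ M) : t ^ q - s ^ q ≤ q * M ^ (q - 1) * (t - s) := by
  rcases eq_or_lt_of_le (hs.trans hst) with h | ht
  · have : s = 0 := by linarith
    simp [← h, this]
  have h1 := one_add_mul_self_le_rpow_one_add (s := s / t - 1) (p := q)
    (by linarith [div_nonneg hs ht.le]) hq.le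
  rw [add_sub_cancel, Real.div_rpow hs ht.le, le_div_iff₀ (by positivity)] at h1
  have h2 : t ^ q = t ^ (q - 1) * t := by
    rw [← Real.rpow_add_one ht.ne', sub_add_cancel]
  have h3 : t ^ q - s ^ q ≤ q * t ^ (q - 1) * (t - s) := by
    have : (1 + q * (s / t - 1)) * t ^ q = t ^ q - q * t ^ (q - 1) * (t - s) := by
      rw [h2]
      field_simp
      ring
    linarith
  refine h3.trans ?_
  have : t ^ (q - 1) ≤ M ^ (q - 1) := Real.rpow_le_rpow ht.le htM (by linarith)
  have h4 : 0 ≤ t - s := by linarith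
  gcongr

/-- The Riesz kernel has uniformly small integral on sets of small measure. -/
theorem exists_setIntegral_norm_rpow_le (hb : 0 < b) (hu : Continuous u) (hpos : ∀ x, 0 < u x)
    (hint : Integrable (fun y => u y ^ q * ‖(0 : EuclideanSpace ℝ (Fin N)) - y‖ ^ (-b)))
    {δ : ℝ} (hδ : 0 < δ) :
    ∃ η : ENNReal, 0 < η ∧ ∀ A : Set (EuclideanSpace ℝ (Fin N)), volume A < η → ∀ x,
      IntegrableOn (fun y => ‖x - y‖ ^ (-b)) A ∧ ∫ y in A, ‖x - y‖ ^ (-b) ≤ δ := by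
  have hmeas (x : EuclideanSpace ℝ (Fin N)) :
      Measurable fun y : EuclideanSpace ℝ (Fin N) => ‖x - y‖ ^ (-b) :=
    (measurable_const.sub measurable_id).norm.pow_const _
  have huq : Continuous fun y => u y ^ q := hu.rpow_const fun x => Or.inl (hpos x).ne'
  obtain ⟨x₀, -, hx₀⟩ := (isCompact_closedBall (0 : EuclideanSpace ℝ (Fin N)) 1).exists_isMinOn
    ⟨0, by simp⟩ huq.continuousOn
  have hc : 0 < u x₀ ^ q := Real.rpow_pos_of_pos (hpos _) _
  have hloc : IntegrableOn (fun y : EuclideanSpace ℝ (Fin N) => ‖y‖ ^ (-b))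
      (Metric.closedBall 0 1) := by
    refine Integrable.mono' (hint.integrableOn.const_mul (u x₀ ^ q)⁻¹)
      (by simpa using (hmeas 0).aestronglyMeasurable)
      ((ae_restrict_mem measurableSet_closedBall).mono fun y hy => ?_)
    rw [Real.norm_of_nonneg (by positivity), zero_sub, norm_neg, ← mul_assoc]
    refine le_mul_of_one_le_left (by positivity) ?_
    rw [inv_mul_eq_div, one_le_div hc]
    exact hx₀ hy
  have hfin : ∫⁻ y in Metric.closedBall (0 : EuclideanSpace ℝ (Fin N)) 1,
      ENNReal.ofReal (‖y‖ ^ (-b)) ≠ ⊤ := by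
    have := hloc.2
    rw [hasFiniteIntegral_iff_ofReal (Eventually.of_forall fun y => by positivity)] at this
    exact this.ne
  set g : EuclideanSpace ℝ (Fin N) → ENNReal :=
    (Metric.closedBall 0 1).indicator fun y => ENNReal.ofReal (‖y‖ ^ (-b)) with hg
  have hgfin : ∫⁻ y, g y ≠ ⊤ := by
    rwa [hg, lintegral_indicator measurableSet_closedBall]
  have hδ2 : ENNReal.ofReal (δ / 2) ≠ 0 := by simpa using hδ
  obtain ⟨η, hη, hη'⟩ := exists_pos_setLIntegral_lt_of_measure_lt hgfin hδ2
  refine ⟨min η (ENNReal.ofReal (δ / 2)), lt_min hη (pos_iff_ne_zero.2 hδ2), fun A hA x => ?_⟩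
  have hle : ∫⁻ y in A, ENNReal.ofReal (‖x - y‖ ^ (-b)) ≤ ENNReal.ofReal δ := by
    have hmp := Measure.measurePreserving_sub_left volume x
    have hemb : MeasurableEmbedding fun y : EuclideanSpace ℝ (Fin N) => x - y :=
      (MeasurableEquiv.subLeft x).measurableEmbedding
    have himg : (fun y => x - y) ⁻¹' ((fun y => x - y) '' A) = A :=
      preimage_image_eq _ hemb.injective
    have h1 := hmp.setLIntegral_comp_emb hemb (fun y => ENNReal.ofReal (‖y‖ ^ (-b))) A
    have h2 : volume ((fun y => x - y) '' A) = volume A := by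
      rw [← hmp.measure_preimage_emb hemb, himg]
    rw [h1]
    have h3 : ∀ y, ENNReal.ofReal (‖y‖ ^ (-b)) ≤ g y + 1 := fun y => by
      by_cases hy : y ∈ Metric.closedBall (0 : EuclideanSpace ℝ (Fin N)) 1
      · simp [hg, hy]
      · have : 1 < ‖y‖ := by simpa using hy
        have : ‖y‖ ^ (-b) ≤ 1 := Real.rpow_le_one_of_one_le_of_nonpos this.le (by linarith)
        exact (ENNReal.ofReal_le_one.2 this).trans le_add_self
    calc _ ≤ ∫⁻ y in (fun y => x - y) '' A, (g y + 1) := lintegral_mono h3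
      _ = (∫⁻ y in (fun y => x - y) '' A, g y) + volume A := by
        rw [lintegral_add_right _ measurable_const]
        simp [h2]
      _ ≤ ENNReal.ofReal (δ / 2) + ENNReal.ofReal (δ / 2) :=
        add_le_add (hη' _ (by rw [h2]; exact hA.trans_le (min_le_left _ _))).le
          (hA.le.trans (min_le_right _ _))
      _ = ENNReal.ofReal δ := by
        rw [← ENNReal.ofReal_add (by positivity) (by positivity), add_halves]
  have hnn : 0 ≤ᵐ[volume.restrict A] fun y => ‖x - y‖ ^ (-b) :=
    Eventually.of_forall fun y => by positivity
  refine ⟨⟨(hmeas x).aestronglyMeasurable, ?_⟩, ?_⟩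
  · rw [hasFiniteIntegral_iff_ofReal hnn]
    exact hle.trans_lt ENNReal.ofReal_lt_top
  · rw [integral_eq_lintegral_of_nonneg_ae hnn (hmeas x).aestronglyMeasurable]
    exact ENNReal.toReal_le_of_le_ofReal hδ.le hle

end MovingSpheres

section MovingSpheres

open EuclideanGeometry

variable {N : ℕ} {b q κ : ℝ} {u : EuclideanSpace ℝ (Fin N) → ℝ}

theorem inversion_zero_eq (r : ℝ) (x : EuclideanSpace ℝ (Fin N)) :
    inversion 0 r x = (r / ‖x‖) ^ 2 • x := by
  simp [inversion_def]

theorem kelvin_nonneg (hpos : ∀ x, 0 < u x) {r : ℝ} (hr : 0 ≤ r) (x : EuclideanSpace ℝ (Fin N)) :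
    0 ≤ kelvin b r u x :=
  mul_nonneg (by positivity) (hpos _).le

theorem measurable_kelvin (hu : Continuous u) (r : ℝ) : Measurable (kelvin b r u) := by
  have h1 : Measurable fun x : EuclideanSpace ℝ (Fin N) => r / ‖x‖ :=
    measurable_const.div measurable_norm
  have h2 : Measurable fun x : EuclideanSpace ℝ (Fin N) => inversion 0 r x := by
    simp only [inversion_zero_eq]
    exact (h1.pow_const 2).smul measurable_id
  exact (h1.pow_const b).mul (hu.measurable.comp h2)

theorem continuousAt_kelvin (hb : 0 < b) (hu : Continuous u) (r : ℝ)
    {x : EuclideanSpace ℝ (Fin N)} (hx : x ≠ 0) :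
    ContinuousAt (fun p : ℝ × EuclideanSpace ℝ (Fin N) => kelvin b p.1 u p.2) (r, x) := by
  have h1 : ContinuousAt (fun p : ℝ × EuclideanSpace ℝ (Fin N) => p.1 / ‖p.2‖) (r, x) :=
    continuousAt_fst.div continuousAt_snd.norm (norm_ne_zero_iff.2 hx)
  have h2 : ContinuousAt (fun p : ℝ × EuclideanSpace ℝ (Fin N) => inversion 0 p.1 p.2) (r, x) := by
    simp only [inversion_zero_eq]
    exact (h1.pow 2).smul continuousAt_snd
  exact (h1.rpow_const (Or.inr hb.le)).mul (hu.continuousAt.comp h2)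

/-- Maximum principle on narrow regions. -/
theorem exists_forall_le_kelvin_of_volume_lt [Nonempty (Fin N)] (hb : 0 < b) (hκ : 0 < κ)
    (hq : 1 < q) (hsub : 0 ≤ 2 * N - b - q * b) (hu : Continuous u) (hpos : ∀ x, 0 < u x)
    (hrep : ∀ x, Integrable (fun y => u y ^ q * ‖x - y‖ ^ (-b)) ∧
      ∫ y, u y ^ q * ‖x - y‖ ^ (-b) = κ * u x) (R : ℝ) :
    ∃ η : ENNReal, 0 < η ∧ ∀ r, 0 < r → r ≤ R →
      volume {x | x ≠ 0 ∧ ‖x‖ < r ∧ kelvin b r u x < u x} < η →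
      ∀ x, x ≠ 0 → ‖x‖ < r → u x ≤ kelvin b r u x := by
  obtain ⟨M, hM⟩ :=
    (isCompact_closedBall (0 : EuclideanSpace ℝ (Fin N)) R).exists_bound_of_continuousOn
    hu.continuousOn
  have hM' (x : EuclideanSpace ℝ (Fin N)) (hx : ‖x‖ < R) : u x ≤ max M 1 :=
    (le_abs_self _).trans ((hM x (by simpa using hx.le)).trans (le_max_left _ _))
  set Q := q * (max M 1) ^ (q - 1) with hQ
  have hQ0 : 0 < Q := mul_pos (by linarith) (Real.rpow_pos_of_pos (by simp) _)
  obtain ⟨η, hη, hη'⟩ := exists_setIntegral_norm_rpow_le hb hu hpos (hrep 0).1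
    (δ := κ / (2 * Q)) (by positivity)
  refine ⟨η, hη, fun r hr hrR hvol => ?_⟩
  by_contra! hcon
  obtain ⟨x₀, hx₀⟩ := hcon
  set A := {x | x ≠ 0 ∧ ‖x‖ < r ∧ kelvin b r u x < u x} with hA
  have hAm : MeasurableSet A := (measurableSet_singleton 0).compl.inter
    ((measurableSet_lt measurable_norm measurable_const).inter
      (measurableSet_lt (measurable_kelvin hu r) hu.measurable))
  have hAB : A ⊆ Metric.ball 0 r := fun x hx => by simpa using hx.2.1
  set S := sSup ((fun x => u x - kelvin b r u x) '' A) with hS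
  have hbdd : BddAbove ((fun x => u x - kelvin b r u x) '' A) := by
    refine ⟨max M 1, ?_⟩
    rintro _ ⟨x, hx, rfl⟩
    have := hM' x (hx.2.1.trans_le hrR)
    have := kelvin_nonneg (b := b) hpos hr.le x
    simp only
    linarith
  have hle (x : EuclideanSpace ℝ (Fin N)) (hx : x ∈ A) : u x - kelvin b r u x ≤ S :=
    le_csSup hbdd ⟨x, hx, rfl⟩
  have hS0 : 0 < S := (sub_pos.2 hx₀.2.2).trans_le (hle x₀ hx₀)
  have hhalf (x : EuclideanSpace ℝ (Fin N)) (hx : x ∈ A) : u x - kelvin b r u x ≤ S / 2 := by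
    obtain ⟨i1, e1⟩ := mul_sub_kelvin_eq hpos hrep hr hx.1
    obtain ⟨i2, e2⟩ := hη' A hvol x
    have hmono : κ * (u x - kelvin b r u x) ≤
        ∫ y in Metric.ball 0 r, A.indicator (fun y => ‖x - y‖ ^ (-b) * (Q * S)) y := by
      rw [e1]
      refine integral_mono_ae i1 ((integrable_indicator_iff hAm).2
        (IntegrableOn.mono_measure (i2.mul_const _) Measure.restrict_le_self)) ?_
      filter_upwards [ae_restrict_mem measurableSet_ball,
        ae_restrict_of_ae (compl_mem_ae_iff.2 (measure_singleton 0)),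
        ae_restrict_of_ae (compl_mem_ae_iff.2 (measure_singleton x))] with y hyr hy0 hyx
      have hyr : ‖y‖ < r := by simpa using hyr
      have hy0 : y ≠ 0 := hy0
      have hk := kelvinKernel_pos hb hr hx.2.1 hyr hy0 (Ne.symm hyx)
      have hk' := kelvinKernel_le (b := b) hr x y
      have hkn := kelvin_nonneg (b := b) hpos hr.le y
      have hone : 1 ≤ (r / ‖y‖) ^ (2 * N - b - q * b) :=
        Real.one_le_rpow ((one_le_div (norm_pos_iff.2 hy0)).2 hyr.le) hsub
      have hD : u y ^ q - (r / ‖y‖) ^ (2 * N - b - q * b) * kelvin b r u y ^ q ≤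
          u y ^ q - kelvin b r u y ^ q :=
        sub_le_sub_left (le_mul_of_one_le_left (Real.rpow_nonneg hkn _) hone) _
      by_cases hyA : y ∈ A
      · rw [indicator_of_mem hyA]
        have h1 := rpow_sub_rpow_le_mul_sub hq hkn hyA.2.2.le (hM' y (hyr.trans_le hrR))
        have h2 : Q * (u y - kelvin b r u y) ≤ Q * S :=
          mul_le_mul_of_nonneg_left (hle y hyA) hQ0.le
        exact (mul_le_mul_of_nonneg_left (hD.trans (h1.trans h2)) hk.le).trans
          (mul_le_mul_of_nonneg_right hk' (by positivity))
      · rw [indicator_of_notMem hyA]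
        have h1 : u y ≤ kelvin b r u y := by
          by_contra! h
          exact hyA ⟨hy0, hyr, h⟩
        have h2 : u y ^ q ≤ kelvin b r u y ^ q :=
          Real.rpow_le_rpow (hpos y).le h1 (by linarith)
        exact mul_nonpos_of_nonneg_of_nonpos hk.le (hD.trans (by linarith))
    rw [setIntegral_indicator hAm, inter_eq_right.2 hAB, integral_mul_const] at hmono
    have h3 : κ * (u x - kelvin b r u x) ≤ κ / (2 * Q) * (Q * S) :=
      hmono.trans (mul_le_mul_of_nonneg_right e2 (by positivity))
    have h4 : κ / (2 * Q) * (Q * S) = κ * (S / 2) := by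
      field_simp
    rw [h4] at h3
    exact le_of_mul_le_mul_left h3 hκ
  have : S ≤ S / 2 := csSup_le ⟨_, x₀, hx₀, rfl⟩ (by rintro _ ⟨x, hx, rfl⟩; exact hhalf x hx)
  linarith

/-- Strong maximum principle. -/
theorem lt_kelvin_of_forall_le [Nonempty (Fin N)] (hb : 0 < b) (hκ : 0 < κ)
    (hq : 1 < q) (hsub : 0 < 2 * N - b - q * b) (hpos : ∀ x, 0 < u x)
    (hrep : ∀ x, Integrable (fun y => u y ^ q * ‖x - y‖ ^ (-b)) ∧
      ∫ y, u y ^ q * ‖x - y‖ ^ (-b) = κ * u x) {r : ℝ} (hr : 0 < r)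
    (hle : ∀ x, x ≠ 0 → ‖x‖ < r → u x ≤ kelvin b r u x)
    {x : EuclideanSpace ℝ (Fin N)} (hx : x ≠ 0) (hxr : ‖x‖ < r) : u x < kelvin b r u x := by
  obtain ⟨i1, e1⟩ := mul_sub_kelvin_eq hpos hrep hr hx
  have hneg : ∀ᵐ y ∂volume.restrict (Metric.ball 0 r), kelvinKernel b r x y *
      (u y ^ q - (r / ‖y‖) ^ (2 * N - b - q * b) * kelvin b r u y ^ q) < 0 := by
    filter_upwards [ae_restrict_mem measurableSet_ball,
      ae_restrict_of_ae (compl_mem_ae_iff.2 (measure_singleton 0)),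
      ae_restrict_of_ae (compl_mem_ae_iff.2 (measure_singleton x))] with y hyr hy0 hyx
    have hyr : ‖y‖ < r := by simpa using hyr
    have hy0 : y ≠ 0 := hy0
    have hk := kelvinKernel_pos hb hr hxr hyr hy0 (Ne.symm hyx)
    have hone : 1 < (r / ‖y‖) ^ (2 * N - b - q * b) :=
      Real.one_lt_rpow ((one_lt_div (norm_pos_iff.2 hy0)).2 hyr) hsub
    have h1 := hle y hy0 hyr
    have h2 : u y ^ q ≤ kelvin b r u y ^ q := Real.rpow_le_rpow (hpos y).le h1 (by linarith)
    have h3 : 0 < kelvin b r u y ^ q := Real.rpow_pos_of_pos ((hpos y).trans_le h1) _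
    exact mul_neg_of_pos_of_neg hk (by nlinarith)
  by_contra! hcon
  have h0 : 0 ≤ ∫ y in Metric.ball 0 r, kelvinKernel b r x y *
      (u y ^ q - (r / ‖y‖) ^ (2 * N - b - q * b) * kelvin b r u y ^ q) := by
    rw [← e1]
    exact mul_nonneg hκ.le (sub_nonneg.2 hcon)
  have h1 := (integral_eq_zero_iff_of_nonneg_ae (hneg.mono fun y hy => neg_nonneg.2 hy.le)
    i1.neg).1 (by
      refine le_antisymm ?_ (integral_nonneg_of_ae (hneg.mono fun y hy => neg_nonneg.2 hy.le))
      simp only [integral_neg]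
      linarith)
  have h2 : ∀ᵐ y ∂volume.restrict (Metric.ball (0 : EuclideanSpace ℝ (Fin N)) r), False := by
    filter_upwards [hneg, h1] with y hy hy'
    have hy' := neg_eq_zero.1 hy'
    linarith
  rw [eventually_false_iff_eq_bot, ae_eq_bot, Measure.restrict_eq_zero] at h2
  exact (Metric.measure_ball_pos volume (0 : EuclideanSpace ℝ (Fin N)) hr).ne' h2

theorem isClosed_setOf_le_kelvin (hb : 0 < b) (hu : Continuous u) :
    IsClosed {r | ∀ x, x ≠ 0 → ‖x‖ < r → u x ≤ kelvin b r u x} := by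
  have : {r | ∀ x, x ≠ 0 → ‖x‖ < r → u x ≤ kelvin b r u x}ᶜ =
      ⋃ x ∈ ({0}ᶜ : Set (EuclideanSpace ℝ (Fin N))), {r | ‖x‖ < r ∧ kelvin b r u x < u x} := by
    ext r
    simpa using exists_congr fun x => and_left_comm
  rw [← isOpen_compl_iff, this]
  refine isOpen_biUnion fun x hx => ?_
  have hc : Continuous fun r => kelvin b r u x := continuous_iff_continuousAt.2 fun r =>
    (continuousAt_kelvin hb hu r hx).comp (f := fun r => (r, x)) (by fun_prop)
  exact (isOpen_lt continuous_const continuous_id).inter (isOpen_lt hc continuous_const)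

theorem forall_le_kelvin [Nonempty (Fin N)] (hb : 0 < b) (hκ : 0 < κ)
    (hq : 1 < q) (hsub : 0 < 2 * N - b - q * b) (hu : Continuous u) (hpos : ∀ x, 0 < u x)
    (hrep : ∀ x, Integrable (fun y => u y ^ q * ‖x - y‖ ^ (-b)) ∧
      ∫ y, u y ^ q * ‖x - y‖ ^ (-b) = κ * u x) {r : ℝ} (hr : 0 ≤ r) :
    ∀ x, x ≠ 0 → ‖x‖ < r → u x ≤ kelvin b r u x := by
  refine IsClosed.Icc_subset_of_forall_mem_nhdsWithin (a := 0) (b := r)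
    (s := {r | ∀ x, x ≠ 0 → ‖x‖ < r → u x ≤ kelvin b r u x})
    ((isClosed_setOf_le_kelvin hb hu).inter isClosed_Icc)
    (fun x _ h => absurd h (norm_nonneg x).not_gt) ?_ (right_mem_Icc.2 hr)
  rintro r₀ ⟨hr₀, h0r, hlt⟩
  obtain ⟨η, hη, hη'⟩ := exists_forall_le_kelvin_of_volume_lt hb hκ hq hsub.le hu hpos hrep r
  set s : Set (EuclideanSpace ℝ (Fin N)) := {0} ∪ Metric.sphere 0 r₀ with hs
  have hsc : IsClosed s := isClosed_singleton.union Metric.isClosed_sphere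
  have hs0 : volume s = 0 :=
    measure_union_null (measure_singleton 0) (Measure.addHaar_sphere _ _ _)
  have hsb : Bornology.IsBounded s := Bornology.isBounded_singleton.union Metric.isBounded_sphere
  have ht := tendsto_measure_cthickening_of_isClosed (μ := volume)
    ⟨1, one_pos, hsb.cthickening.measure_lt_top.ne⟩ hsc
  rw [hs0] at ht
  obtain ⟨ε, hεη, hε⟩ := ((ht.mono_left nhdsWithin_le_nhds).eventually_lt_const hη |>.and
    self_mem_nhdsWithin : ∀ᶠ ε in 𝓝[>] (0 : ℝ), _ ∧ ε ∈ Ioi 0).exists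
  have hε : 0 < ε := hε
  have hK : IsCompact (Metric.closedBall 0 r₀ \ Metric.thickening ε s) :=
    (isCompact_closedBall _ _).diff Metric.isOpen_thickening
  have hKs {x : EuclideanSpace ℝ (Fin N)}
      (hx : x ∈ Metric.closedBall 0 r₀ \ Metric.thickening ε s) :
      x ≠ 0 ∧ ‖x‖ < r₀ := by
    have hxs : x ∉ s := fun h => hx.2 (Metric.self_subset_thickening hε s h)
    refine ⟨fun h => hxs (Or.inl h), lt_of_le_of_ne (by simpa using hx.1) fun h => hxs (Or.inr ?_)⟩
    simpa using h
  have hev := hK.eventually_forall_of_forall_eventually (x₀ := r₀)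
    (P := fun r x => u x < kelvin b r u x) fun x hx => by
      obtain ⟨hx0, hxr⟩ := hKs hx
      exact (hu.continuousAt.comp continuousAt_snd).eventually_lt (continuousAt_kelvin hb hu r₀ hx0)
        (lt_kelvin_of_forall_le hb hκ hq hsub hpos hrep ((norm_nonneg x).trans_lt hxr) hr₀ hx0 hxr)
  filter_upwards [hev.filter_mono nhdsWithin_le_nhds,
    Ioo_mem_nhdsGT (lt_min hlt (lt_add_of_pos_right r₀ hε))] with t htK ⟨ht1, ht2⟩
  rw [lt_min_iff] at ht2
  refine hη' t (h0r.trans_lt ht1) ht2.1.le ((measure_mono ?_).trans_lt hεη)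
  rintro x ⟨hx0, hxt, hxu⟩
  rcases le_or_gt ‖x‖ r₀ with hx | hx
  · by_contra hxs
    exact (htK x ⟨by simpa using hx,
      fun h => hxs (Metric.thickening_subset_cthickening _ _ h)⟩).not_gt hxu
  · have hx0' : 0 < ‖x‖ := norm_pos_iff.2 hx0
    refine Metric.mem_cthickening_of_dist_le x ((r₀ / ‖x‖) • x) ε s (Or.inr ?_) ?_
    · simp only [mem_sphere_zero_iff_norm, norm_smul, norm_div, norm_norm, Real.norm_of_nonneg h0r]
      field_simp
    · rw [dist_eq_norm]
      have : x - (r₀ / ‖x‖) • x = ((‖x‖ - r₀) / ‖x‖) • x := by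
        rw [sub_div, div_self hx0'.ne', sub_smul, one_smul]
      rw [this, norm_smul, norm_div, norm_norm, Real.norm_of_nonneg (by linarith),
        div_mul_cancel₀ _ hx0'.ne']
      linarith

end MovingSpheres

section Liouville

open EuclideanGeometry

variable {N m : ℕ} {b q : ℝ} {u : EuclideanSpace ℝ (Fin N) → ℝ}

theorem mul_rpow_le_of_le_kelvin
    (hle : ∀ r : ℝ, 0 ≤ r → ∀ x, x ≠ 0 → ‖x‖ < r → u x ≤ kelvin b r u x) {c : ℝ}
    (hc : ∀ x, ‖x‖ = 1 → c ≤ u x) {x : EuclideanSpace ℝ (Fin N)} (hx : 1 < ‖x‖) :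
    c * ‖x‖ ^ (-(b / 2)) ≤ u x := by
  have hx0 : 0 < ‖x‖ := one_pos.trans hx
  have hr : 0 < √‖x‖ := Real.sqrt_pos.2 hx0
  have hz : ‖inversion 0 √‖x‖ x‖ = 1 := by
    rw [← dist_zero_right, dist_inversion_center, dist_zero_right, Real.sq_sqrt hx0.le,
      div_self hx0.ne']
  have h1 := hle √‖x‖ hr.le (inversion 0 √‖x‖ x) (fun h => by simp [h] at hz)
    (by rw [hz]; exact Real.lt_sqrt_of_sq_lt (by simpa using hx))
  rw [kelvin, hz, inversion_inversion 0 hr.ne', div_one] at h1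
  have h2 : √‖x‖ ^ b * ‖x‖ ^ (-(b / 2)) = 1 := by
    rw [Real.sqrt_eq_rpow, ← Real.rpow_mul hx0.le, ← Real.rpow_add hx0]
    ring_nf
    exact Real.rpow_zero _
  calc c * ‖x‖ ^ (-(b / 2)) ≤ √‖x‖ ^ b * u x * ‖x‖ ^ (-(b / 2)) := by
        gcongr
        exact (hc _ hz).trans h1
    _ = u x := by linear_combination u x * h2

theorem eq_zero_of_lt (hm : 0 < m) (hNm : 2 * m < N) (hq : 1 < q)
    (hq2 : q < ((N : ℝ) + 2 * m) / ((N : ℝ) - 2 * m))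
    (hu : ContDiff ℝ (2 * m : ℕ) u) (hpos : ∀ x, 0 ≤ u x)
    (heq : ∀ x, polyLap m u x = u x ^ q) (x : EuclideanSpace ℝ (Fin N)) : u x = 0 := by
  by_contra hx
  have : Nonempty (Fin N) := ⟨0, by omega⟩
  set b := (N : ℝ) - 2 * m with hb
  have hb0 : 0 < b := by
    have : ((2 * m : ℕ) : ℝ) < N := by exact_mod_cast hNm
    push_cast at this
    linarith
  rw [lt_div_iff₀ hb0] at hq2
  obtain ⟨κ, hκ⟩ := exists_lintegral_eq hm hNm hq hu hpos heq
  obtain ⟨hκ0, hu0, hrep⟩ := integrable_and_integral_eq hu.continuous hpos hx hκ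
  have hle (r : ℝ) (hr : 0 ≤ r) := forall_le_kelvin (r := r) hb0 hκ0 hq (by linarith)
    hu.continuous hu0 hrep hr
  obtain ⟨z, hz, hzmin⟩ := (isCompact_sphere (0 : EuclideanSpace ℝ (Fin N)) 1).exists_isMinOn
    (NormedSpace.sphere_nonempty.2 zero_le_one) hu.continuous.continuousOn
  have hlow {x : EuclideanSpace ℝ (Fin N)} (hx : 1 < ‖x‖) : u z * ‖x‖ ^ (-(b / 2)) ≤ u x :=
    mul_rpow_le_of_le_kelvin hle (fun y hy => hzmin (by simpa using hy)) hx
  obtain ⟨C, hC, hE⟩ := exists_setIntegral_rpow_comp_le hq hu hpos heq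
  set T : Set (EuclideanSpace ℝ (Fin N)) := Metric.ball 0 1 \ Metric.closedBall 0 (1 / 2) with hT
  have hTo : IsOpen T := Metric.isOpen_ball.sdiff Metric.isClosed_closedBall
  have hTm : volume T ≠ ⊤ := (measure_mono sdiff_subset).trans_lt measure_ball_lt_top |>.ne
  have hTpos : 0 < volume.real T := by
    refine ENNReal.toReal_pos (hTo.measure_pos volume ⟨(3 / 4 : ℝ) • z, ?_⟩).ne' hTm
    have hz1 : ‖z‖ = 1 := by simpa using hz
    simp only [hT, Set.mem_sdiff, mem_ball_zero_iff, mem_closedBall_zero_iff, norm_smul, hz1]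
    norm_num
  have hbound (R : ℝ) (hR : 2 < R) :
      volume.real T * u z ^ q ≤ C * R ^ (-(2 * m * q / (q - 1) - b * q / 2)) := by
    have hR0 : 0 < R := by linarith
    have hcont : Continuous fun y => u (0 + R • y) ^ q :=
      (hu.continuous.comp (by fun_prop)).rpow_const fun _ => Or.inr (by linarith)
    have h1 : ∫ y in T, (u z * R ^ (-(b / 2))) ^ q ≤ ∫ y in T, u (0 + R • y) ^ q := by
      refine setIntegral_mono_on (integrableOn_const hTm)
        ((integrableOn_ball_of_continuous hcont 0 1).mono_set sdiff_subset) hTo.measurableSet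
        fun y hy => ?_
      simp only [hT, Set.mem_sdiff, mem_ball_zero_iff, mem_closedBall_zero_iff, not_le] at hy
      have hn : ‖(0 : EuclideanSpace ℝ (Fin N)) + R • y‖ = R * ‖y‖ := by
        rw [zero_add, norm_smul, Real.norm_of_nonneg hR0.le]
      have h2 : 1 < ‖(0 : EuclideanSpace ℝ (Fin N)) + R • y‖ := by
        rw [hn]
        nlinarith
      refine Real.rpow_le_rpow (by have := hu0 z; positivity) (le_trans ?_ (hlow h2)) (by linarith)
      refine mul_le_mul_of_nonneg_left ?_ (hu0 z).le
      refine Real.rpow_le_rpow_of_nonpos (one_pos.trans h2) ?_ (by linarith)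
      rw [hn]
      nlinarith
    have h2 : ∫ y in T, u (0 + R • y) ^ q ≤ ∫ y in Metric.ball 0 1, u (0 + R • y) ^ q :=
      setIntegral_mono_set (integrableOn_ball_of_continuous hcont 0 1)
        (Eventually.of_forall fun y => Real.rpow_nonneg (hpos _) _) sdiff_subset.eventuallyLE
    have h3 := h1.trans (h2.trans (hE 0 R hR0))
    rw [setIntegral_const, smul_eq_mul, Real.mul_rpow (hu0 z).le (by positivity),
      ← Real.rpow_mul hR0.le, ← mul_assoc] at h3
    have h4 : R ^ (-(b / 2) * q) * R ^ (b * q / 2) = 1 := by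
      rw [← Real.rpow_add hR0]
      ring_nf
      exact Real.rpow_zero _
    calc volume.real T * u z ^ q
        = volume.real T * u z ^ q * R ^ (-(b / 2) * q) * R ^ (b * q / 2) := by
          rw [mul_assoc _ (R ^ _), h4, mul_one]
      _ ≤ C * R ^ (-(2 * m * q / (q - 1))) * R ^ (b * q / 2) := by gcongr
      _ = _ := by
          rw [mul_assoc, ← Real.rpow_add hR0]
          ring_nf
  have hs : 0 < 2 * m * q / (q - 1) - b * q / 2 := by
    have hq1 : 0 < q - 1 := by linarith
    rw [sub_pos, div_lt_div_iff₀ two_pos hq1]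
    nlinarith
  have hlim : Tendsto (fun R : ℝ => C * R ^ (-(2 * m * q / (q - 1) - b * q / 2))) atTop (𝓝 0) := by
    simpa using (tendsto_rpow_neg_atTop hs).const_mul C
  have := ge_of_tendsto hlim ((eventually_gt_atTop 2).mono hbound)
  exact (mul_pos hTpos (Real.rpow_pos_of_pos (hu0 z) q)).not_ge this

end Liouville

end PolyharmonicLiouville

/-- Liouville theorem on the whole space: a nonnegative `C^{2m}` solution of
`(-Δ)^m u = u^q` in `ℝ^N`, with `q > 1` subcritical, vanishes identically. -/
theorem stmt_0 {N m : ℕ} (hN : 0 < N) (hm : 0 < m) (q : ℝ)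
    (hq1 : 1 < q) (hq2 : 2 * m < N → q < ((N : ℝ) + 2 * m) / ((N : ℝ) - 2 * m))
    (u : EuclideanSpace ℝ (Fin N) → ℝ)
    (hu : ContDiff ℝ (2 * m : ℕ) u)
    (hpos : ∀ x, 0 ≤ u x)
    (heq : ∀ x, polyLap m u x = u x ^ q) :
    ∀ x, u x = 0 := by
  rcases le_or_gt N (2 * m) with h | h
  · exact eq_zero_of_le hm h hq1 hu hpos heq
  · exact eq_zero_of_lt hm h hq1 (hq2 h) hu hpos heq
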